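/- Let P be a convex lattice polygon with exactly g interior lattice points. If g = 7 or g = 8, then the lattice width of P is at most 4; if g = 9 or g = 11, then the lattice width of P is at most 5; and if g = 12, then the lattice width of P is at most 6. -/

import Mathlib

/-- The canonical inclusion of the lattice `ℤ²` into the plane `ℝ²`. -/
def toReal2 (p : ℤ × ℤ) : ℝ × ℝ := ((p.1 : ℝ), (p.2 : ℝ))

/-- The lattice points of a subset of the plane. -/
def latticePoints (P : Set (ℝ × ℝ)) : Set (ℤ × ℤ) := {p | toReal2 p ∈ P}

/-- The interior lattice points of a subset of the plane. -/
def interiorLatticePoints (P : Set (ℝ × ℝ)) : Set (ℤ × ℤ) := {p | toReal2 p ∈ interior P}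

/-- The width of `P` in the direction of the integer linear functional `(u,v) ↦ au + bv`,
i.e. the difference between the sup and the inf of this functional on the lattice points
of `P`. -/
noncomputable def dirWidth (P : Set (ℝ × ℝ)) (φ : ℤ × ℤ) : ℤ :=
  sSup ((fun p : ℤ × ℤ => φ.1 * p.1 + φ.2 * p.2) '' latticePoints P) -
    sInf ((fun p : ℤ × ℤ => φ.1 * p.1 + φ.2 * p.2) '' latticePoints P)

/-- The lattice width of `P`: the minimum of the directional widths over all nonzero
integer linear functionals. -/
noncomputable def latticeWidth (P : Set (ℝ × ℝ)) : ℤ :=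
  sInf {w | ∃ φ : ℤ × ℤ, φ ≠ 0 ∧ w = dirWidth P φ}

/-- The pairing of an integer functional with a lattice point. -/
def pairing (φ p : ℤ × ℤ) : ℤ := φ.1 * p.1 + φ.2 * p.2

/-- The determinant of two integer vectors. -/
def det2 (φ ψ : ℤ × ℤ) : ℤ := φ.1 * ψ.2 - φ.2 * ψ.1

/-- A set of lattice points that contains every lattice point which is a convex combination,
with rational weights, of three of its elements. -/
def LatticeConvex (B : Set (ℤ × ℤ)) : Prop :=
  ∀ a ∈ B, ∀ b ∈ B, ∀ c ∈ B, ∀ α β γ : ℤ, 0 ≤ α → 0 ≤ β → 0 ≤ γ → 0 < α + β + γ →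
    ∀ q : ℤ × ℤ, (α + β + γ) * q.1 = α * a.1 + β * b.1 + γ * c.1 →
      (α + β + γ) * q.2 = α * a.2 + β * b.2 + γ * c.2 → q ∈ B

/-- Every nonzero integer functional varies by at least `w` on `B`. -/
def WidthAtLeast (w : ℤ) (B : Set (ℤ × ℤ)) : Prop :=
  ∀ φ : ℤ × ℤ, φ ≠ 0 → ∃ p ∈ B, ∃ r ∈ B, w ≤ pairing φ p - pairing φ r

/-- In suitable unimodular coordinates `B` lies in the square `[0, w] × [0, w]`. -/
def FitsInSquare (w : ℤ) (B : Set (ℤ × ℤ)) : Prop :=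
  ∃ f₁ f₂ : ℤ × ℤ, ∃ c₁ c₂ : ℤ, det2 f₁ f₂ = 1 ∧
    ∀ p ∈ B, (0 ≤ pairing f₁ p - c₁ ∧ pairing f₁ p - c₁ ≤ w) ∧
      (0 ≤ pairing f₂ p - c₂ ∧ pairing f₂ p - c₂ ≤ w)

lemma LatticeConvex.diff_singleton {B : Set (ℤ × ℤ)} (hB : LatticeConvex B) {v ψ : ℤ × ℤ}
    (hψ : ∀ p ∈ B, p ≠ v → pairing ψ p < pairing ψ v) : LatticeConvex (B \ {v}) := by
  rintro a ⟨ha, hav⟩ b ⟨hb, hbv⟩ c ⟨hc, hcv⟩ α β γ hα hβ hγ hn q h1 h2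
  refine ⟨hB a ha b hb c hc α β γ hα hβ hγ hn q h1 h2, ?_⟩
  rintro rfl
  have h3 := hψ a ha hav
  have h4 := hψ b hb hbv
  have h5 := hψ c hc hcv
  have h6 : (α + β + γ) * pairing ψ q = α * pairing ψ a + β * pairing ψ b + γ * pairing ψ c := by
    unfold pairing; linear_combination ψ.1 * h1 + ψ.2 * h2
  have h7 := mul_nonneg hα (by linarith : 0 ≤ pairing ψ q - pairing ψ a - 1)
  have h8 := mul_nonneg hβ (by linarith : 0 ≤ pairing ψ q - pairing ψ b - 1)
  have h9 := mul_nonneg hγ (by linarith : 0 ≤ pairing ψ q - pairing ψ c - 1)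
  nlinarith

lemma eq_of_pairing_eq {ℓ m p r : ℤ × ℤ} (h : det2 ℓ m ≠ 0) (h1 : pairing ℓ p = pairing ℓ r)
    (h2 : pairing m p = pairing m r) : p = r := by
  unfold pairing det2 at *
  ext
  · apply mul_left_cancel₀ h; linear_combination m.2 * h1 - ℓ.2 * h2
  · apply mul_left_cancel₀ h; linear_combination ℓ.1 * h2 - m.1 * h1

/-- A lexicographic maximum of two independent functionals is the unique maximum of a single
functional. -/
lemma exists_lex_max {B : Set (ℤ × ℤ)} (hfin : B.Finite) (hne : B.Nonempty) {ℓ m : ℤ × ℤ}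
    (hℓm : det2 ℓ m ≠ 0) :
    ∃ z ∈ B, (∀ p ∈ B, pairing ℓ p ≤ pairing ℓ z) ∧
      ∃ ψ, ∀ p ∈ B, p ≠ z → pairing ψ p < pairing ψ z := by
  obtain ⟨y, hy, hymax⟩ := Set.exists_max_image B (pairing ℓ) hfin hne
  obtain ⟨z, ⟨hz, hzy⟩, hzmax⟩ := Set.exists_max_image {p ∈ B | pairing ℓ p = pairing ℓ y}
    (pairing m) (hfin.subset (Set.sep_subset _ _)) ⟨y, hy, rfl⟩
  obtain ⟨t, ht, htmax⟩ := Set.exists_max_image B (pairing m) hfin hne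
  refine ⟨z, hz, fun p hp => hzy ▸ hymax p hp, ?_⟩
  set N := pairing m t - pairing m z + 1 with hN
  have hNpos : 0 < N := by have := htmax z hz; omega
  refine ⟨(N * ℓ.1 + m.1, N * ℓ.2 + m.2), fun p hp hpz => ?_⟩
  have hexp : ∀ r : ℤ × ℤ, pairing (N * ℓ.1 + m.1, N * ℓ.2 + m.2) r
      = N * pairing ℓ r + pairing m r := by
    intro r; unfold pairing; ring
  rw [hexp, hexp]
  have h1 : pairing ℓ p ≤ pairing ℓ z := hzy ▸ hymax p hp
  rcases h1.lt_or_eq with h | h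
  · have h2 := htmax p hp
    nlinarith
  · have h2 := hzmax p ⟨hp, h.trans hzy⟩
    have h3 : pairing m p ≠ pairing m z := fun h3 => hpz (eq_of_pairing_eq hℓm h h3)
    have : pairing m p < pairing m z := lt_of_le_of_ne h2 h3
    rw [h]; omega

lemma exists_primitive {φ : ℤ × ℤ} (h : φ ≠ 0) :
    ∃ g : ℤ, 0 < g ∧ ∃ χ : ℤ × ℤ, IsCoprime χ.1 χ.2 ∧ φ = (g * χ.1, g * χ.2) := by
  have hpos : 0 < Int.gcd φ.1 φ.2 := by
    rw [Int.gcd_pos_iff]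
    by_contra! h'
    exact h (Prod.ext h'.1 h'.2)
  obtain ⟨g, a, b, hg, hc, h1, h2⟩ := Int.exists_gcd_one' hpos
  refine ⟨g, by exact_mod_cast hg, (a, b), Int.isCoprime_iff_gcd_eq_one.2 hc, ?_⟩
  ext <;> simp [h1, h2, mul_comm]

/-- If removing `v` destroys the width bound, some primitive functional has small width away
from `v` and is strictly maximal at `v`. -/
lemma exists_functional_of_not_widthAtLeast {w : ℤ} (hw : 2 ≤ w) {B : Set (ℤ × ℤ)}
    (hB : WidthAtLeast w B) {v : ℤ × ℤ} (hv : v ∈ B) (hnot : ¬ WidthAtLeast w (B \ {v})) :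
    ∃ φ : ℤ × ℤ, IsCoprime φ.1 φ.2 ∧
      (∀ p ∈ B, p ≠ v → ∀ r ∈ B, r ≠ v → pairing φ p - pairing φ r ≤ w - 1) ∧
      ∀ p ∈ B, p ≠ v → pairing φ p < pairing φ v := by
  unfold WidthAtLeast at hnot
  push Not at hnot
  obtain ⟨φ, hφ, hsmall⟩ := hnot
  obtain ⟨g, hg, χ, hχ, rfl⟩ := exists_primitive hφ
  have hexp : ∀ r, pairing (g * χ.1, g * χ.2) r = g * pairing χ r := by
    intro r; unfold pairing; ring
  have hχsmall : ∀ p ∈ B, p ≠ v → ∀ r ∈ B, r ≠ v → pairing χ p - pairing χ r ≤ w - 1 := by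
    intro p hp hpv r hr hrv
    have := hsmall p ⟨hp, hpv⟩ r ⟨hr, hrv⟩
    rw [hexp, hexp] at this
    by_contra! hcon
    nlinarith
  have hχ0 : χ ≠ 0 := by
    rintro rfl
    simp at hφ
  obtain ⟨p, hp, r, hr, hpr⟩ := hB χ hχ0
  by_cases hpv : p = v
  · subst hpv
    refine ⟨χ, hχ, hχsmall, fun s hs hsv => ?_⟩
    have hrp : r ≠ p := by rintro rfl; omega
    have := hχsmall s hs hsv r hr hrp
    omega
  · by_cases hrv : r = v
    · subst hrv
      have hneg : ∀ s, pairing (-χ) s = - pairing χ s := by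
        intro s; unfold pairing; simp; ring
      refine ⟨-χ, hχ.neg_neg, fun a ha har b hb hbr => ?_, fun s hs hsv => ?_⟩
      · have := hχsmall b hb hbr a ha har
        rw [hneg, hneg]; omega
      · have := hχsmall p hp hpv s hs hsv
        rw [hneg, hneg]; omega
    · have := hχsmall p hp hpv r hr hrv
      omega

lemma pairing_sub (φ p r : ℤ × ℤ) : pairing φ (p - r) = pairing φ p - pairing φ r := by
  unfold pairing; simp; ring

/-- If the lattice point `v + (-s₂, s₁)` is missing from `B`, then all of `B \ {v}` lies strictly
on one side of the line through `v` and that point. -/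
lemma LatticeConvex.one_side {B : Set (ℤ × ℤ)} (hB : LatticeConvex B) {v : ℤ × ℤ} (hv : v ∈ B)
    {s t : ℤ × ℤ} (hst : det2 s t = 1) (ht : ∀ p ∈ B, p ≠ v → 1 ≤ pairing t (p - v))
    (he : (v.1 - s.2, v.2 + s.1) ∉ B) :
    (∀ p ∈ B, p ≠ v → 1 ≤ pairing s (p - v)) ∨ (∀ p ∈ B, p ≠ v → pairing s (p - v) ≤ -1) := by
  by_contra! hcon
  obtain ⟨⟨q, hq, hqv, hqs⟩, p, hp, hpv, hps⟩ := hcon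
  apply he
  have hp1 := ht p hp hpv
  have hq1 := ht q hq hqv
  have key : ∀ r : ℤ × ℤ, r.1 - v.1 = t.2 * pairing s (r - v) - s.2 * pairing t (r - v) ∧
      r.2 - v.2 = s.1 * pairing t (r - v) - t.1 * pairing s (r - v) := by
    intro r
    unfold pairing det2 at *
    simp only [Prod.fst_sub, Prod.snd_sub]
    constructor
    · linear_combination -(r.1 - v.1) * hst
    · linear_combination -(r.2 - v.2) * hst
  obtain ⟨kp1, kp2⟩ := key p
  obtain ⟨kq1, kq2⟩ := key q
  set sp := pairing s (p - v)
  set sq := pairing s (q - v)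
  set tp := pairing t (p - v)
  set tq := pairing t (q - v)
  by_cases h0 : sp = 0
  · refine hB p hp v hv v hv 1 (tp - 1) 0 (by norm_num) (by omega) le_rfl (by omega) _ ?_ ?_
    · simp only; rw [h0] at kp1; linear_combination -kp1
    · simp only; rw [h0] at kp2; linear_combination -kp2
  · have hsp : 0 < sp := by omega
    have hsq : 0 ≤ -sq := by omega
    have h1 := mul_nonneg hsq (by omega : 0 ≤ tp - 1)
    have h2 := mul_nonneg hsp.le (by omega : 0 ≤ tq - 1)
    refine hB p hp q hq v hv (-sq) sp (-sq * tp + sp * tq + sq - sp) hsq hsp.le (by nlinarith)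
      (by nlinarith) _ ?_ ?_
    · simp only; linear_combination sq * kp1 - sp * kq1
    · simp only; linear_combination sq * kp2 - sp * kq2

/-- Euclidean descent on a vertex cone: a strictly positive functional `d * f₁ + b * f₂` of
minimum at least `h` with `f₁, f₂` positive and unimodular reduces to the case `d + b ≥ h`. -/
lemma fitsInSquare_of_cone {B : Set (ℤ × ℤ)} (hB : LatticeConvex B) {w : ℤ} (hw : 2 ≤ w)
    (hwB : WidthAtLeast w B) {v : ℤ × ℤ} (hv : v ∈ B) {χ : ℤ × ℤ} {h : ℤ}
    (hlow : ∀ p ∈ B, p ≠ v → h ≤ pairing χ (p - v))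
    (hupp : ∀ p ∈ B, p ≠ v → pairing χ (p - v) ≤ h + w - 1) (n : ℕ) :
    ∀ (f₁ f₂ : ℤ × ℤ) (d b : ℤ), 2 * h - d - b ≤ n → det2 f₁ f₂ = 1 →
      (∀ p ∈ B, p ≠ v → 1 ≤ pairing f₁ (p - v)) → (∀ p ∈ B, p ≠ v → 1 ≤ pairing f₂ (p - v)) →
      (∀ p, pairing χ p = d * pairing f₁ p + b * pairing f₂ p) → 1 ≤ d → 1 ≤ b → 1 ≤ h →
      FitsInSquare w B := by
  have big : ∀ f : ℤ × ℤ, f ≠ 0 → (∀ p ∈ B, p ≠ v → 1 ≤ pairing f (p - v)) →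
      ∃ p ∈ B, p ≠ v ∧ w ≤ pairing f (p - v) := by
    intro f hf hpos
    obtain ⟨p, hp, r, hr, hpr⟩ := hwB f hf
    have hr0 : 0 ≤ pairing f (r - v) := by
      by_cases hrv : r = v
      · subst hrv; simp [pairing]
      · linarith [hpos r hr hrv]
    rw [pairing_sub] at hr0
    have : w ≤ pairing f (p - v) := by rw [pairing_sub]; omega
    refine ⟨p, hp, ?_, this⟩
    rintro rfl
    simp [pairing] at this
    omega
  induction n with
  | zero =>
    intro f₁ f₂ d b hn hdet h1 h2 hχ hd hb hh
    by_cases hlt : d + b < h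
    · simp only [Nat.cast_zero] at hn
      omega
    have hf1 : f₁ ≠ 0 := by rintro rfl; simp [det2] at hdet
    obtain ⟨p, hp, hpv, hpw⟩ := big f₁ hf1 h1
    have ha := hupp p hp hpv
    have hc := h2 p hp hpv
    rw [hχ] at ha
    simp only [Nat.cast_zero] at hn
    exfalso
    nlinarith
  | succ n ih =>
    intro f₁ f₂ d b hn hdet h1 h2 hχ hd hb hh
    by_cases hlt : d + b < h
    · have hs : det2 (f₁ - f₂) f₂ = 1 := by
        unfold det2 at *; simp only [Prod.fst_sub, Prod.snd_sub]; linear_combination hdet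
      have hsub : ∀ p, pairing (f₁ - f₂) p = pairing f₁ p - pairing f₂ p := by
        intro p; unfold pairing; simp only [Prod.fst_sub, Prod.snd_sub]; ring
      have hsub' : ∀ p, pairing (f₂ - f₁) p = pairing f₂ p - pairing f₁ p := by
        intro p; unfold pairing; simp only [Prod.fst_sub, Prod.snd_sub]; ring
      have he : (v.1 - (f₁ - f₂).2, v.2 + (f₁ - f₂).1) ∉ B := by
        intro hmem
        have e1 : pairing f₁ ((v.1 - (f₁ - f₂).2, v.2 + (f₁ - f₂).1) - v) = 1 := by
          unfold pairing det2 at *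
          simp only [Prod.fst_sub, Prod.snd_sub]; linear_combination hdet
        have e2 : pairing f₂ ((v.1 - (f₁ - f₂).2, v.2 + (f₁ - f₂).1) - v) = 1 := by
          unfold pairing det2 at *
          simp only [Prod.fst_sub, Prod.snd_sub]; linear_combination hdet
        have hne : (v.1 - (f₁ - f₂).2, v.2 + (f₁ - f₂).1) ≠ v := by
          intro heq
          rw [heq] at e1
          simp [pairing] at e1
        have := hlow _ hmem hne
        rw [hχ, e1, e2] at this
        omega
      push_cast at hn
      rcases hB.one_side hv hs h2 he with hside | hside
      · refine ih (f₁ - f₂) f₂ d (d + b) (by omega) hs hside h2 (fun p => ?_) hd (by omega) hh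
        rw [hχ, hsub]; ring
      · refine ih f₁ (f₂ - f₁) (d + b) b (by omega) ?_ h1 (fun p hp hpv => ?_) (fun p => ?_)
          (by omega) hb hh
        · unfold det2 at *; simp only [Prod.fst_sub, Prod.snd_sub]; linear_combination hdet
        · have := hside p hp hpv
          rw [hsub] at this
          rw [hsub']; omega
        · rw [hχ, hsub']; ring
    · have hf1 : f₁ ≠ 0 := by rintro rfl; simp [det2] at hdet
      have hf2 : f₂ ≠ 0 := by rintro rfl; simp [det2] at hdet
      have hd1 : d = 1 := by
        obtain ⟨p, hp, hpv, hpw⟩ := big f₁ hf1 h1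
        have ha := hupp p hp hpv
        have hc := h2 p hp hpv
        rw [hχ] at ha
        nlinarith
      have hb1 : b = 1 := by
        obtain ⟨p, hp, hpv, hpw⟩ := big f₂ hf2 h2
        have ha := hupp p hp hpv
        have hc := h1 p hp hpv
        rw [hχ] at ha
        nlinarith
      subst hd1 hb1
      refine ⟨f₁, f₂, pairing f₁ v, pairing f₂ v, hdet, fun p hp => ?_⟩
      by_cases hpv : p = v
      · subst hpv; omega
      · have a1 := h1 p hp hpv
        have a2 := h2 p hp hpv
        have a3 := hupp p hp hpv
        rw [hχ] at a3
        rw [pairing_sub] at a1 a2 a3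
        rw [pairing_sub] at a3
        omega

lemma fitsInSquare_or_width_le {B : Set (ℤ × ℤ)} (hB : LatticeConvex B) (hfin : B.Finite) {w : ℤ}
    (hw : 2 ≤ w) (hwB : WidthAtLeast w B) {v : ℤ × ℤ} (hv : v ∈ B) {φ : ℤ × ℤ}
    (hφ : IsCoprime φ.1 φ.2)
    (hsmall : ∀ p ∈ B, p ≠ v → ∀ r ∈ B, r ≠ v → pairing φ p - pairing φ r ≤ w - 1)
    (hmax : ∀ p ∈ B, p ≠ v → pairing φ p < pairing φ v) :
    FitsInSquare w B ∨ ∀ p ∈ B, ∀ r ∈ B, pairing φ p - pairing φ r ≤ w := by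
  have hneg : ∀ s, pairing (-φ) s = - pairing φ s := by
    intro s; unfold pairing; simp; ring
  have hne : (B \ {v}).Nonempty := by
    obtain ⟨p, hp, r, hr, hpr⟩ := hwB (1, 0) (by simp)
    by_cases hpv : p = v
    · refine ⟨r, hr, ?_⟩
      rintro rfl
      subst hpv; omega
    · exact ⟨p, hp, hpv⟩
  obtain ⟨p₀, ⟨hp₀, hp₀v⟩, hmin⟩ := Set.exists_min_image (B \ {v}) (fun p => pairing (-φ) (p - v))
    (hfin.subset Set.sdiff_subset) hne
  set χ := -φ with hχ
  set h := pairing χ (p₀ - v) with hh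
  have hlow : ∀ p ∈ B, p ≠ v → h ≤ pairing χ (p - v) := fun p hp hpv => hmin p ⟨hp, hpv⟩
  have hupp : ∀ p ∈ B, p ≠ v → pairing χ (p - v) ≤ h + w - 1 := by
    intro p hp hpv
    have := hsmall p₀ hp₀ hp₀v p hp hpv
    rw [hh, pairing_sub, pairing_sub, hneg, hneg, hneg]; omega
  have hh1 : 1 ≤ h := by
    have := hmax p₀ hp₀ hp₀v
    rw [hh, pairing_sub, hneg, hneg]; omega
  rcases hh1.eq_or_lt with h1 | h2
  · right
    intro p hp r hr
    by_cases hpv : p = v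
    · by_cases hrv : r = v
      · subst hpv hrv; omega
      · have := hupp r hr hrv
        rw [pairing_sub, hneg, hneg] at this
        subst hpv; omega
    · by_cases hrv : r = v
      · have := hmax p hp hpv
        subst hrv; omega
      · have := hsmall p hp hpv r hr hrv
        omega
  · left
    obtain ⟨a, b, hab⟩ := hφ.neg_neg
    have hdet0 : det2 (b, -a) χ = 1 := by
      unfold det2; simp only [hχ, Prod.fst_neg, Prod.snd_neg]; linear_combination hab
    have missing : ∀ s : ℤ × ℤ, det2 s χ = 1 → (v.1 - s.2, v.2 + s.1) ∉ B := by
      intro s hs hmem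
      have e : pairing χ ((v.1 - s.2, v.2 + s.1) - v) = 1 := by
        unfold pairing det2 at *
        simp only [Prod.fst_sub, Prod.snd_sub]; linear_combination hs
      have hne : (v.1 - s.2, v.2 + s.1) ≠ v := by
        intro heq
        rw [heq] at e
        simp [pairing] at e
      have := hlow _ hmem hne
      omega
    set f : ℤ × ℤ := (b, -a) with hf
    set k := pairing f (p₀ - v) / h with hk
    have hdm := Int.emod_add_mul_ediv (pairing f (p₀ - v)) h
    have hm0 := Int.emod_nonneg (pairing f (p₀ - v)) (by omega : h ≠ 0)
    have hmh := Int.emod_lt_of_pos (pairing f (p₀ - v)) (by omega : 0 < h)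
    rw [← hk] at hdm
    have hcomb : ∀ (j : ℤ) (p : ℤ × ℤ), pairing (f.1 - j * χ.1, f.2 - j * χ.2) p
        = pairing f p - j * pairing χ p := by
      intro j p; unfold pairing; ring
    have hcdet : ∀ j : ℤ, det2 (f.1 - j * χ.1, f.2 - j * χ.2) χ = 1 := by
      intro j; unfold det2 at *; simp only; linear_combination hdet0
    have hχpos : ∀ p ∈ B, p ≠ v → 1 ≤ pairing χ (p - v) := fun p hp hpv => by
      linarith [hlow p hp hpv]
    have s1 : ∀ p ∈ B, p ≠ v → 1 ≤ pairing (f.1 - k * χ.1, f.2 - k * χ.2) (p - v) := by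
      rcases hB.one_side hv (hcdet k) hχpos (missing _ (hcdet k)) with hs | hs
      · exact hs
      · have := hs p₀ hp₀ hp₀v
        rw [hcomb, ← hh] at this
        nlinarith
    have s2 : ∀ p ∈ B, p ≠ v →
        pairing (f.1 - (k + 1) * χ.1, f.2 - (k + 1) * χ.2) (p - v) ≤ -1 := by
      rcases hB.one_side hv (hcdet (k + 1)) hχpos (missing _ (hcdet (k + 1))) with hs | hs
      · have := hs p₀ hp₀ hp₀v
        rw [hcomb, ← hh] at this
        nlinarith
      · exact hs
    have hcomb' : ∀ p, pairing ((k + 1) * χ.1 - f.1, (k + 1) * χ.2 - f.2) p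
        = (k + 1) * pairing χ p - pairing f p := by
      intro p; unfold pairing; ring
    refine fitsInSquare_of_cone hB hw hwB hv hlow hupp (2 * h).toNat
      (f.1 - k * χ.1, f.2 - k * χ.2) ((k + 1) * χ.1 - f.1, (k + 1) * χ.2 - f.2) 1 1
      (by omega) ?_ s1 (fun p hp hpv => ?_) (fun p => ?_) le_rfl le_rfl hh1
    · unfold det2 at *; simp only; linear_combination hdet0
    · have := s2 p hp hpv
      rw [hcomb] at this
      rw [hcomb']; linarith
    · rw [hcomb, hcomb']; ring

lemma fitsInSquare_of_width_le {B : Set (ℤ × ℤ)} (hfin : B.Finite) (hne : B.Nonempty) {w : ℤ}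
    {φ ψ : ℤ × ℤ} (hφ : IsCoprime φ.1 φ.2) (hdet : det2 φ ψ ≠ 0)
    (h1 : ∀ p ∈ B, ∀ r ∈ B, pairing φ p - pairing φ r ≤ w)
    (h2 : ∀ p ∈ B, ∀ r ∈ B, pairing ψ p - pairing ψ r ≤ w) : FitsInSquare w B := by
  wlog hpos : 0 < det2 φ ψ generalizing ψ
  · have hneg : ∀ s, pairing (-ψ) s = - pairing ψ s := by
      intro s; unfold pairing; simp; ring
    have hd : det2 φ (-ψ) = - det2 φ ψ := by
      unfold det2; simp only [Prod.fst_neg, Prod.snd_neg]; ring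
    refine this (ψ := -ψ) (by omega) (fun p hp r hr => ?_) (by omega)
    rw [hneg, hneg]
    linarith [h2 r hr p hp]
  obtain ⟨a, b, hab⟩ := hφ
  set m := det2 φ ψ with hm
  set n := ψ.1 * a + ψ.2 * b with hn
  set k := (2 * n + m) / (2 * m) with hk
  have hdm := Int.emod_add_mul_ediv (2 * n + m) (2 * m)
  have hm0 := Int.emod_nonneg (2 * n + m) (by omega : 2 * m ≠ 0)
  have hmh := Int.emod_lt_of_pos (2 * n + m) (by omega : 0 < 2 * m)
  rw [← hk] at hdm
  set e := m * k - n with he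
  have he1 : 2 * e ≤ m := by rw [he]; linarith
  have he2 : -m < 2 * e := by rw [he]; linarith
  set f : ℤ × ℤ := (-b + k * φ.1, a + k * φ.2) with hf
  have hcomb : ∀ p, m * pairing f p = pairing ψ p + e * pairing φ p := by
    intro p
    rw [he, hn, hm, hf]
    unfold pairing det2
    simp only
    linear_combination ((ψ.1 * p.1 + ψ.2 * p.2)) * hab
  have h3 : ∀ p ∈ B, ∀ r ∈ B, pairing f p - pairing f r ≤ w := by
    intro p hp r hr
    have a1 := h1 p hp r hr
    have a2 := h1 r hr p hp
    have a3 := h2 p hp r hr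
    have hw0 : 0 ≤ w := by linarith
    have a4 : e * (pairing φ p - pairing φ r) ≤ |e| * w := by
      calc _ ≤ |e * (pairing φ p - pairing φ r)| := le_abs_self _
        _ = |e| * |pairing φ p - pairing φ r| := abs_mul _ _
        _ ≤ |e| * w := mul_le_mul_of_nonneg_left (abs_le.2 ⟨by linarith, a1⟩) (abs_nonneg _)
    have a5 : m * (pairing f p - pairing f r) ≤ (1 + |e|) * w := by
      have := hcomb p
      have := hcomb r
      linarith
    have a6 : 1 + |e| ≤ m := by
      rcases abs_cases e with ⟨h, _⟩ | ⟨h, _⟩ <;> rw [h] <;> omega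
    have a7 : m * (pairing f p - pairing f r) ≤ m * w :=
      a5.trans (mul_le_mul_of_nonneg_right a6 hw0)
    exact le_of_mul_le_mul_left a7 hpos
  obtain ⟨x, hx, hxm⟩ := Set.exists_min_image B (pairing φ) hfin hne
  obtain ⟨y, hy, hym⟩ := Set.exists_min_image B (pairing f) hfin hne
  refine ⟨φ, f, pairing φ x, pairing f y, ?_, fun p hp => ?_⟩
  · unfold det2; simp only [hf]; linear_combination hab
  · have := hxm p hp
    have := hym p hp
    have := h1 p hp x hx
    have := h3 p hp y hy
    omega

/-- A finite lattice-convex set of width at least `w` has a lattice-convex subset, still of width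
at least `w`, which fits in a unimodular square of side `w`. -/
lemma exists_fitsInSquare {A : Set (ℤ × ℤ)} (hfin : A.Finite) (hconv : LatticeConvex A) {w : ℤ}
    (hw : 2 ≤ w) (hwA : WidthAtLeast w A) :
    ∃ B ⊆ A, LatticeConvex B ∧ WidthAtLeast w B ∧ FitsInSquare w B := by
  have hfins : {B : Set (ℤ × ℤ) | B ⊆ A ∧ LatticeConvex B ∧ WidthAtLeast w B}.Finite :=
    hfin.finite_subsets.subset fun B hB => hB.1
  obtain ⟨B, ⟨hBA, hB, hwB⟩, hmin⟩ := hfins.exists_minimal ⟨A, subset_rfl, hconv, hwA⟩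
  refine ⟨B, hBA, hB, hwB, ?_⟩
  have hBfin := hfin.subset hBA
  have hex : ∀ v ∈ B, (∃ ψ, ∀ p ∈ B, p ≠ v → pairing ψ p < pairing ψ v) →
      ∃ φ : ℤ × ℤ, IsCoprime φ.1 φ.2 ∧ (∀ p ∈ B, p ≠ v → pairing φ p < pairing φ v) ∧
        (FitsInSquare w B ∨ ∀ p ∈ B, ∀ r ∈ B, pairing φ p - pairing φ r ≤ w) := by
    rintro v hv ⟨ψ, hψ⟩
    have hnot : ¬ WidthAtLeast w (B \ {v}) := by
      intro hcon
      have := hmin (y := B \ {v}) ⟨Set.sdiff_subset.trans hBA, hB.diff_singleton hψ, hcon⟩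
        Set.sdiff_subset hv
      exact this.2 rfl
    obtain ⟨φ, hφ, hsmall, hmax⟩ := exists_functional_of_not_widthAtLeast hw hwB hv hnot
    exact ⟨φ, hφ, hmax, fitsInSquare_or_width_le hB hBfin hw hwB hv hφ hsmall hmax⟩
  have hne : B.Nonempty := by
    obtain ⟨p, hp, -⟩ := hwB (1, 0) (by simp)
    exact ⟨p, hp⟩
  obtain ⟨v, hv, -, hvψ⟩ := exists_lex_max hBfin hne (ℓ := (1, 0)) (m := (0, 1)) (by simp [det2])
  obtain ⟨φ, hφ, hφmax, hfit | hφw⟩ := hex v hv hvψ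
  · exact hfit
  have hφ0 : φ ≠ 0 := by
    rintro rfl
    obtain ⟨a, b, hab⟩ := hφ
    simp at hab
  obtain ⟨u, hu, humin⟩ := Set.exists_min_image B (pairing φ) hBfin hne
  have huv : pairing φ u < pairing φ v := by
    refine hφmax u hu ?_
    rintro rfl
    obtain ⟨p, hp, r, hr, hpr⟩ := hwB φ hφ0
    have h1 := humin p hp
    have h2 := humin r hr
    by_cases hpu : p = u
    · subst hpu; omega
    · have := hφmax p hp hpu; omega
  obtain ⟨ℓ, hℓu, hℓφ, p, hp, hℓp⟩ : ∃ ℓ : ℤ × ℤ, pairing ℓ u = pairing ℓ v ∧ det2 ℓ φ ≠ 0 ∧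
      ∃ p ∈ B, pairing ℓ v < pairing ℓ p := by
    have hd : det2 (v.2 - u.2, u.1 - v.1) φ = pairing φ v - pairing φ u := by
      unfold det2 pairing; ring
    have hd' : det2 (u.2 - v.2, v.1 - u.1) φ = pairing φ u - pairing φ v := by
      unfold det2 pairing; ring
    have hℓ0 : ((v.2 - u.2, u.1 - v.1) : ℤ × ℤ) ≠ 0 := by
      intro h0
      rw [h0] at hd
      simp [det2] at hd
      omega
    obtain ⟨p, hp, r, hr, hpr⟩ := hwB _ hℓ0
    by_cases hpv : pairing (v.2 - u.2, u.1 - v.1) v < pairing (v.2 - u.2, u.1 - v.1) p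
    · exact ⟨_, by unfold pairing; ring, by rw [hd]; omega, p, hp, hpv⟩
    · refine ⟨(u.2 - v.2, v.1 - u.1), by unfold pairing; ring, by rw [hd']; omega, r, hr, ?_⟩
      unfold pairing at *
      simp only at *
      linarith
  obtain ⟨z, hz, hzℓ, hzψ⟩ := exists_lex_max hBfin hne hℓφ
  have hzp := hzℓ p hp
  have hzv : v ≠ z := by rintro rfl; omega
  have hzu : u ≠ z := by rintro rfl; omega
  obtain ⟨φ', hφ', hφ'max, hfit | hφ'w⟩ := hex z hz hzψ
  · exact hfit
  refine fitsInSquare_of_width_le hBfin hne hφ ?_ hφw hφ'w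
  intro hdet
  obtain ⟨a, b, hab⟩ := hφ
  have hpar : ∀ s, pairing φ' s = (a * φ'.1 + b * φ'.2) * pairing φ s := by
    intro s
    unfold pairing det2 at *
    linear_combination (-φ'.1 * s.1 - φ'.2 * s.2) * hab + (a * s.2 - b * s.1) * hdet
  have g1 := hφ'max v hv hzv
  have g2 := hφ'max u hu hzu
  have g3 := hφmax z hz (Ne.symm hzv)
  have g4 := humin z hz
  rw [hpar, hpar z] at g1 g2
  set c := a * φ'.1 + b * φ'.2
  rcases le_or_gt 0 c with hc | hc
  · have := mul_le_mul_of_nonneg_left g3.le hc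
    omega
  · have := mul_le_mul_of_nonpos_left g4 hc.le
    omega

/-- Moving one step horizontally towards smaller values of the functional `(α, σ)`, `α = ±1`,
stays inside a lattice-convex set that has points of smaller value both weakly below and weakly
above. -/
lemma LatticeConvex.step_mem {C : Set (ℤ × ℤ)} (hC : LatticeConvex C) {α σ : ℤ} (hα : α * α = 1)
    {b t p : ℤ × ℤ} (hb : b ∈ C) (ht : t ∈ C) (hp : p ∈ C) (hbp : b.2 ≤ p.2) (hpt : p.2 ≤ t.2)
    (hub : pairing (α, σ) b < pairing (α, σ) p) (hut : pairing (α, σ) t < pairing (α, σ) p) :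
    (p.1 - α, p.2) ∈ C := by
  unfold pairing at *
  simp only at hub hut
  rcases eq_or_lt_of_le (hbp.trans hpt) with h | h
  · have h1 : b.2 = p.2 := by omega
    rw [h1] at hub
    refine hC p hp b hb b hb (α * (p.1 - b.1) - 1) 1 0 (by linarith) (by norm_num) le_rfl
      (by linarith) _ ?_ ?_
    · simp only; linear_combination (b.1 - p.1) * hα
    · simp only; rw [h1]; ring
  · have h1 := mul_nonneg (by omega : 0 ≤ t.2 - p.2)
      (by omega : 0 ≤ (α * p.1 + σ * p.2) - (α * b.1 + σ * b.2) - 1)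
    have h2 := mul_nonneg (by omega : 0 ≤ p.2 - b.2)
      (by omega : 0 ≤ (α * p.1 + σ * p.2) - (α * t.1 + σ * t.2) - 1)
    have hD : 0 < t.2 - b.2 := by omega
    refine hC p hp b hb t ht
      (α * (p.1 * (t.2 - b.2) - (t.2 - p.2) * b.1 - (p.2 - b.2) * t.1) - (t.2 - b.2))
      (t.2 - p.2) (p.2 - b.2) (by linarith) (by omega) (by omega) (by linarith) _ ?_ ?_
    · simp only
      linear_combination (-(p.1 * (t.2 - b.2) - (t.2 - p.2) * b.1 - (p.2 - b.2) * t.1)) * hα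
    · simp only; ring

lemma LatticeConvex.exists_level {C : Set (ℤ × ℤ)} (hC : LatticeConvex C) {α σ : ℤ}
    (hα : α * α = 1) {b t : ℤ × ℤ} (hb : b ∈ C) (ht : t ∈ C) {K : ℤ}
    (hub : pairing (α, σ) b ≤ K) (hut : pairing (α, σ) t ≤ K) {p : ℤ × ℤ} (hp : p ∈ C)
    (hbp : b.2 ≤ p.2) (hpt : p.2 ≤ t.2) (hK : K ≤ pairing (α, σ) p) :
    ∃ q ∈ C, pairing (α, σ) q = K := by
  obtain ⟨n, hn⟩ := Int.eq_ofNat_of_zero_le (sub_nonneg.2 hK)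
  induction n generalizing p with
  | zero => exact ⟨p, hp, by simp at hn; omega⟩
  | succ n ih =>
    push_cast at hn
    have h1 : pairing (α, σ) (p.1 - α, p.2) = pairing (α, σ) p - 1 := by
      unfold pairing; simp only; linear_combination -hα
    exact ih (hC.step_mem (σ := σ) hα hb ht hp hbp hpt (by omega) (by omega)) hbp hpt (by omega)
      (by omega)

/-- Two points of `C` on the lines `x + y = k` and `x + y = w + k`. -/
lemma exists_antidiagonal_levels {C : Set (ℤ × ℤ)} (hC : LatticeConvex C) {w : ℤ}
    (hwC : WidthAtLeast w C) (hfin : C.Finite)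
    (hbox : ∀ p ∈ C, (0 ≤ p.1 ∧ p.1 ≤ w) ∧ 0 ≤ p.2 ∧ p.2 ≤ w) {a b c e : ℤ}
    (ha : (0, a) ∈ C) (hc : (c, 0) ∈ C) (hb : (w, b) ∈ C) (he : (e, w) ∈ C)
    (h : max b e ≤ min a c) :
    ∃ k, max b e ≤ k ∧ k ≤ min a c ∧ (∃ i, 0 ≤ i ∧ i ≤ w - k ∧ (w - i, k + i) ∈ C) ∧
      ∃ j, 0 ≤ j ∧ j ≤ k ∧ (j, k - j) ∈ C := by
  have ba := hbox _ ha
  have bb := hbox _ hb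
  have bc := hbox _ hc
  have be := hbox _ he
  simp only at ba bb bc be
  obtain ⟨x, hx, hxmin⟩ := Set.exists_min_image C (pairing (1, 1)) hfin ⟨_, ha⟩
  obtain ⟨y, hy, hymax⟩ := Set.exists_max_image C (pairing (1, 1)) hfin ⟨_, ha⟩
  obtain ⟨p, hp, r, hr, hpr⟩ := hwC (1, 1) (by simp)
  have h1 := hxmin r hr
  have h2 := hymax p hp
  have h3 := hxmin _ ha
  have h4 := hxmin _ hc
  have h5 := hymax _ hb
  have h6 := hymax _ he
  have bx := hbox x hx
  have bby := hbox y hy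
  have hneg : ∀ s, pairing (-1, -1) s = - pairing (1, 1) s := by
    intro s; unfold pairing; ring
  have hval : ∀ s t : ℤ, pairing (1, 1) (s, t) = s + t := by
    intro s t; unfold pairing; ring
  simp only [hval] at h3 h4 h5 h6
  have ex := hval x.1 x.2
  have ey := hval y.1 y.2
  rw [Prod.mk.eta] at ex ey
  obtain ⟨k, hk1, hk2, hk3, hk4⟩ : ∃ k, max b e ≤ k ∧ k ≤ min a c ∧ pairing (1, 1) x ≤ k ∧
      w + k ≤ pairing (1, 1) y := by
    rcases le_total (pairing (1, 1) x) (max b e) with h7 | h7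
    · exact ⟨max b e, le_rfl, h, h7, by omega⟩
    · exact ⟨pairing (1, 1) x, h7, by omega, le_rfl, by omega⟩
  refine ⟨k, hk1, hk2, ?_, ?_⟩
  · obtain ⟨q, hq, hqK⟩ := hC.exists_level (α := 1) (σ := 1) (by norm_num) hc he
      (K := w + k) (by rw [hval]; omega) (by rw [hval]; omega) hy
      (by simp only; omega) (by simp only; omega) (by omega)
    have bq := hbox q hq
    have hqv := hval q.1 q.2
    rw [Prod.mk.eta, hqK] at hqv
    refine ⟨w - q.1, by omega, by omega, ?_⟩
    convert hq using 1
    exact Prod.ext (by simp only; omega) (by simp only; omega)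
  · obtain ⟨q, hq, hqK⟩ := hC.exists_level (α := -1) (σ := -1) (by norm_num) hc he
      (K := -k) (by rw [hneg, hval]; omega)
      (by rw [hneg, hval]; omega) hx (by simp only; omega) (by simp only; omega)
      (by rw [hneg]; omega)
    have bq := hbox q hq
    have hqv := hval q.1 q.2
    rw [hneg] at hqK
    rw [Prod.mk.eta] at hqv
    refine ⟨q.1, by omega, by omega, ?_⟩
    convert hq using 1
    exact Prod.ext rfl (by simp only; omega)

/-- Two points of `C` on the lines `x - y = k` and `x - y = k - w`. -/
lemma exists_diagonal_levels {C : Set (ℤ × ℤ)} (hC : LatticeConvex C) {w : ℤ}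
    (hwC : WidthAtLeast w C) (hfin : C.Finite)
    (hbox : ∀ p ∈ C, (0 ≤ p.1 ∧ p.1 ≤ w) ∧ 0 ≤ p.2 ∧ p.2 ≤ w) {a b c e : ℤ}
    (ha : (0, a) ∈ C) (hc : (c, 0) ∈ C) (hb : (w, b) ∈ C) (he : (e, w) ∈ C)
    (h : max c (w - b) ≤ min (w - a) e) :
    ∃ k, max c (w - b) ≤ k ∧ k ≤ min (w - a) e ∧ (∃ i, 0 ≤ i ∧ i ≤ w - k ∧ (k + i, i) ∈ C) ∧
      ∃ j, 0 ≤ j ∧ j ≤ k ∧ (j, w - k + j) ∈ C := by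
  have ba := hbox _ ha
  have bb := hbox _ hb
  have bc := hbox _ hc
  have be := hbox _ he
  simp only at ba bb bc be
  obtain ⟨x, hx, hxmin⟩ := Set.exists_min_image C (pairing (1, -1)) hfin ⟨_, ha⟩
  obtain ⟨y, hy, hymax⟩ := Set.exists_max_image C (pairing (1, -1)) hfin ⟨_, ha⟩
  obtain ⟨p, hp, r, hr, hpr⟩ := hwC (1, -1) (by simp)
  have h1 := hxmin r hr
  have h2 := hymax p hp
  have h3 := hxmin _ ha
  have h4 := hymax _ hc
  have h5 := hymax _ hb
  have h6 := hxmin _ he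
  have bx := hbox x hx
  have bby := hbox y hy
  have hneg : ∀ s, pairing (-1, 1) s = - pairing (1, -1) s := by
    intro s; unfold pairing; ring
  have hval : ∀ s t : ℤ, pairing (1, -1) (s, t) = s - t := by
    intro s t; unfold pairing; ring
  simp only [hval] at h3 h4 h5 h6
  have ex := hval x.1 x.2
  have ey := hval y.1 y.2
  rw [Prod.mk.eta] at ex ey
  obtain ⟨k, hk1, hk2, hk3, hk4⟩ : ∃ k, max c (w - b) ≤ k ∧ k ≤ min (w - a) e ∧
      pairing (1, -1) x + w ≤ k ∧ k ≤ pairing (1, -1) y := by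
    rcases le_total (pairing (1, -1) x + w) (max c (w - b)) with h7 | h7
    · exact ⟨max c (w - b), le_rfl, h, h7, by omega⟩
    · exact ⟨pairing (1, -1) x + w, h7, by omega, le_rfl, by omega⟩
  refine ⟨k, hk1, hk2, ?_, ?_⟩
  · obtain ⟨q, hq, hqK⟩ := hC.exists_level (α := 1) (σ := -1) (by norm_num) hc he
      (K := k) (by rw [hval]; omega)
      (by rw [hval]; omega) hy (by simp only; omega) (by simp only; omega) (by omega)
    have bq := hbox q hq
    have hqv := hval q.1 q.2
    rw [Prod.mk.eta, hqK] at hqv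
    refine ⟨q.2, by omega, by omega, ?_⟩
    convert hq using 1
    exact Prod.ext (by simp only; omega) rfl
  · obtain ⟨q, hq, hqK⟩ := hC.exists_level (α := -1) (σ := 1) (by norm_num) hc he
      (K := w - k) (by rw [hneg, hval]; omega)
      (by rw [hneg, hval]; omega) hx (by simp only; omega) (by simp only; omega)
      (by rw [hneg]; omega)
    have bq := hbox q hq
    have hqv := hval q.1 q.2
    rw [hneg] at hqK
    rw [Prod.mk.eta] at hqv
    refine ⟨q.1, by omega, by omega, ?_⟩
    convert hq using 1
    exact Prod.ext rfl (by simp only; omega)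

/-- The properties shared by the set `A` of lattice points and the set `I` of interior lattice
points of a lattice polygon: a point seen counterclockwise around a closed chain of points of `A`
is interior, and an interior point is not extremal for any functional. -/
structure IsLatticeInterior (A I : Set (ℤ × ℤ)) : Prop where
  finite : I.Finite
  mem_of_surrounded : ∀ L : List (ℤ × ℤ), L ≠ [] → (∀ p ∈ L, p ∈ A) → ∀ q : ℤ × ℤ,
    (∀ p ∈ L, ∃ a ∈ L, 0 < det2 (p - q) (a - q)) → q ∈ I
  exists_lt : ∀ q ∈ I, ∀ φ : ℤ × ℤ, φ ≠ 0 → ∃ p ∈ A, pairing φ p < pairing φ q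

/-! The Boolean functions below are evaluated by the kernel; they are written with raw recursors
and `Nat` primitives to keep that evaluation fast. -/

def kAnd (a b : Bool) : Bool := @Bool.rec (fun _ => Bool) false b a

def kOr (a b : Bool) : Bool := @Bool.rec (fun _ => Bool) b true a

def kAll {α : Type} (l : List α) (f : α → Bool) : Bool :=
  @List.rec α (fun _ => Bool) true (fun a _ ih => kAnd (f a) ih) l

def kAny {α : Type} (l : List α) (f : α → Bool) : Bool :=
  @List.rec α (fun _ => Bool) false (fun a _ ih => kOr (f a) ih) l

/-- `kCount f l n` says that at least `n` entries of `l` satisfy `f`. -/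
def kCount {α : Type} (f : α → Bool) (l : List α) : ℕ → Bool :=
  @List.rec α (fun _ => ℕ → Bool) (fun n => Nat.beq n 0)
    (fun a _ ih n => @Nat.rec (fun _ => Bool) true
      (fun m _ => @Bool.rec (fun _ => Bool) (ih n) (ih m) (f a)) n) l

def kMax (a b : ℕ) : ℕ := @Bool.rec (fun _ => ℕ) a b (Nat.ble a b)

def kMin (a b : ℕ) : ℕ := @Bool.rec (fun _ => ℕ) b a (Nat.ble a b)

def kEq (p q : ℕ × ℕ) : Bool := kAnd (Nat.beq p.1 q.1) (Nat.beq p.2 q.2)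

/-- `a` is to the left of `p` as seen from `q`. -/
def kLeft (q p a : ℕ × ℕ) : Bool :=
  Nat.ble (Nat.succ (Nat.add (Nat.add (Nat.mul p.1 q.2) (Nat.mul q.1 a.2)) (Nat.mul p.2 a.1)))
    (Nat.add (Nat.add (Nat.mul p.1 a.2) (Nat.mul p.2 q.1)) (Nat.mul q.2 a.1))

def kLeftAny (q p a b c : ℕ × ℕ) : Bool := kOr (kLeft q p a) (kOr (kLeft q p b) (kLeft q p c))

/-- The point `q` is surrounded by the closed chain `a b c d`. -/
def inQuad (a b c d q : ℕ × ℕ) : Bool :=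
  kAnd (kLeftAny q a b c d) (kAnd (kLeftAny q b c d a)
    (kAnd (kLeftAny q c d a b) (kLeftAny q d a b c)))

/-- The point `q` is surrounded by the closed chain `a b c d e f`. -/
def inHexagon (a b c d e f q : ℕ × ℕ) : Bool :=
  kAnd (kLeftAny q a b c d) (kAnd (kLeftAny q b c d e) (kAnd (kLeftAny q c d e f)
    (kAnd (kLeftAny q d e f a) (kAnd (kLeftAny q e f a b) (kLeftAny q f a b c)))))

/-- Parameters of the search in the square of side `side`: the bound `count` on the number of
interior points, the coordinate range, the points tested, and the exceptional triangles. -/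
structure SquareSearch where
  side : ℕ
  count : ℕ
  range : List ℕ
  grid : List (ℕ × ℕ)
  triangles : List ((ℕ × ℕ) × (ℕ × ℕ) × (ℕ × ℕ))

namespace SquareSearch

def hasTriangle (D : SquareSearch) (l : List (ℕ × ℕ)) : Bool :=
  kAny D.triangles fun t =>
    kAnd (kAny l (kEq t.1)) (kAnd (kAny l (kEq t.2.1)) (kAny l (kEq t.2.2)))

def quad (D : SquareSearch) (a b c d : ℕ × ℕ) : Bool :=
  kOr (kCount (inQuad a b c d) D.grid D.count) (D.hasTriangle [a, b, c, d])

def hexagon (D : SquareSearch) (a b c d e f : ℕ × ℕ) : Bool :=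
  kOr (kCount (inHexagon a b c d e f) D.grid D.count) (D.hasTriangle [a, b, c, d, e, f])

def between (D : SquareSearch) (lo hi : ℕ) (f : ℕ → Bool) : Bool :=
  kAll D.range fun k => kOr (Nat.ble (Nat.succ k) lo) (kOr (Nat.ble (Nat.succ hi) k) (f k))

def antidiagonals (D : SquareSearch) (a b c e lo hi : ℕ) : Bool :=
  kAnd (Nat.ble (Nat.succ lo) hi) (D.between lo hi fun k =>
    D.between 0 (Nat.sub D.side k) fun i => D.between 0 k fun j =>
      D.hexagon (0, a) (j, Nat.sub k j) (c, 0) (D.side, b) (Nat.sub D.side i, Nat.add k i)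
        (e, D.side))

def diagonals (D : SquareSearch) (a b c e lo hi : ℕ) : Bool :=
  kAnd (Nat.ble (Nat.succ lo) hi) (D.between lo hi fun k =>
    D.between 0 (Nat.sub D.side k) fun i => D.between 0 k fun j =>
      D.hexagon (0, a) (c, 0) (Nat.add k i, i) (D.side, b) (e, D.side)
        (j, Nat.add (Nat.sub D.side k) j))

/-- For all positions `(0, a)`, `(c, 0)`, `(side, b)`, `(e, side)` of contact points, up to
rotation, one finds `count` surrounded points or an exceptional triangle, if necessary by means
of two further points on parallel diagonals. -/
def run (D : SquareSearch) : Bool :=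
  D.between 0 D.side fun a => D.between (Nat.sub D.side a) D.side fun c =>
    D.between (Nat.sub D.side a) D.side fun b => D.between 0 a fun e =>
      kOr (D.quad (0, a) (c, 0) (D.side, b) (e, D.side))
        (kOr (D.antidiagonals a b c e (kMax b e) (kMin a c))
          (D.diagonals a b c e (kMax c (Nat.sub D.side b)) (kMin (Nat.sub D.side a) e)))

end SquareSearch

lemma kAnd_eq_true {a b : Bool} : kAnd a b = true ↔ a = true ∧ b = true := by
  cases a <;> simp [kAnd]

lemma kOr_eq_true {a b : Bool} : kOr a b = true ↔ a = true ∨ b = true := by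
  cases a <;> simp [kOr]

lemma kAll_eq_true {α : Type} {l : List α} {f : α → Bool} :
    kAll l f = true ↔ ∀ a ∈ l, f a = true := by
  induction l with
  | nil => simp [kAll]
  | cons a l ih =>
    have : kAll (a :: l) f = kAnd (f a) (kAll l f) := rfl
    rw [this, kAnd_eq_true, ih, List.forall_mem_cons]

lemma kAny_eq_true {α : Type} {l : List α} {f : α → Bool} :
    kAny l f = true ↔ ∃ a ∈ l, f a = true := by
  induction l with
  | nil => simp [kAny]
  | cons a l ih =>
    have : kAny (a :: l) f = kOr (f a) (kAny l f) := rfl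
    rw [this, kOr_eq_true, ih, List.exists_mem_cons_iff]

lemma le_length_filter_of_kCount {α : Type} {f : α → Bool} {l : List α} {n : ℕ}
    (h : kCount f l n = true) : n ≤ (l.filter f).length := by
  induction l generalizing n with
  | nil =>
    have : Nat.beq n 0 = true := h
    simp [Nat.eq_of_beq_eq_true this]
  | cons a l ih =>
    cases n with
    | zero => exact Nat.zero_le _
    | succ m =>
      have h' : @Bool.rec (fun _ => Bool) (kCount f l (m + 1)) (kCount f l m) (f a) = true := h
      cases hfa : f a with
      | false =>
        rw [hfa] at h'
        simpa [List.filter_cons, hfa] using ih h'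
      | true =>
        rw [hfa] at h'
        simpa [List.filter_cons, hfa] using ih h'

lemma kMax_eq (a b : ℕ) : kMax a b = max a b := by
  unfold kMax
  cases h : Nat.ble a b with
  | false =>
    have : ¬ a ≤ b := fun h' => Bool.noConfusion (h.symm.trans (Nat.ble_eq_true_of_le h'))
    simp only; omega
  | true =>
    have := Nat.le_of_ble_eq_true h
    simp only; omega

lemma kMin_eq (a b : ℕ) : kMin a b = min a b := by
  unfold kMin
  cases h : Nat.ble a b with
  | false =>
    have : ¬ a ≤ b := fun h' => Bool.noConfusion (h.symm.trans (Nat.ble_eq_true_of_le h'))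
    simp only; omega
  | true =>
    have := Nat.le_of_ble_eq_true h
    simp only; omega

lemma kEq_eq_true {p q : ℕ × ℕ} : kEq p q = true ↔ p = q := by
  rw [kEq, kAnd_eq_true, Nat.beq_eq, Nat.beq_eq, Prod.ext_iff]

/-- The inclusion of `ℕ²` into `ℤ²`. -/
def toInt2 (p : ℕ × ℕ) : ℤ × ℤ := ((p.1 : ℤ), (p.2 : ℤ))

lemma toInt2_injective : Function.Injective toInt2 := by
  rintro ⟨a, b⟩ ⟨c, d⟩ h
  simpa [toInt2] using h

lemma det2_pos_of_kLeft {q p a : ℕ × ℕ} (h : kLeft q p a = true) :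
    0 < det2 (toInt2 p - toInt2 q) (toInt2 a - toInt2 q) := by
  have h1 := Nat.le_of_ble_eq_true h
  simp only [Nat.add_eq, Nat.mul_eq, Nat.succ_eq_add_one] at h1
  zify at h1
  unfold det2 toInt2
  simp only [Prod.fst_sub, Prod.snd_sub]
  linarith

lemma exists_det2_pos_of_kLeftAny {q p a b c : ℕ × ℕ} (h : kLeftAny q p a b c = true) :
    ∃ x ∈ [a, b, c], 0 < det2 (toInt2 p - toInt2 q) (toInt2 x - toInt2 q) := by
  rw [kLeftAny, kOr_eq_true, kOr_eq_true] at h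
  rcases h with h | h | h <;> exact ⟨_, by simp, det2_pos_of_kLeft h⟩

namespace IsLatticeInterior

variable {A I : Set (ℤ × ℤ)}

lemma mem_of_kLeftAny (hI : IsLatticeInterior A I) {L : List (ℕ × ℕ)} (hne : L ≠ [])
    (hL : ∀ p ∈ L, toInt2 p ∈ A) {q : ℕ × ℕ}
    (h : ∀ p ∈ L, ∃ a ∈ L, ∃ b ∈ L, ∃ c ∈ L, kLeftAny q p a b c = true) : toInt2 q ∈ I := by
  refine hI.mem_of_surrounded (L.map toInt2) (by simpa using hne)
    (List.forall_mem_map.2 hL) _ (List.forall_mem_map.2 fun p hp => ?_)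
  obtain ⟨a, ha, b, hb, c, hc, habc⟩ := h p hp
  obtain ⟨x, hx, hxpos⟩ := exists_det2_pos_of_kLeftAny habc
  refine ⟨toInt2 x, List.mem_map_of_mem ?_, hxpos⟩
  simp only [List.mem_cons, List.not_mem_nil, or_false] at hx
  rcases hx with rfl | rfl | rfl <;> assumption

lemma mem_of_inQuad (hI : IsLatticeInterior A I) {a b c d q : ℕ × ℕ}
    (hA : ∀ p ∈ [a, b, c, d], toInt2 p ∈ A) (h : inQuad a b c d q = true) : toInt2 q ∈ I := by
  simp only [inQuad, kAnd_eq_true] at h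
  refine hI.mem_of_kLeftAny (by simp) hA fun p hp => ?_
  simp only [List.mem_cons, List.not_mem_nil, or_false] at hp
  rcases hp with rfl | rfl | rfl | rfl
  · exact ⟨_, by simp, _, by simp, _, by simp, h.1⟩
  · exact ⟨_, by simp, _, by simp, _, by simp, h.2.1⟩
  · exact ⟨_, by simp, _, by simp, _, by simp, h.2.2.1⟩
  · exact ⟨_, by simp, _, by simp, _, by simp, h.2.2.2⟩

lemma mem_of_inHexagon (hI : IsLatticeInterior A I) {a b c d e f q : ℕ × ℕ}
    (hA : ∀ p ∈ [a, b, c, d, e, f], toInt2 p ∈ A) (h : inHexagon a b c d e f q = true) :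
    toInt2 q ∈ I := by
  simp only [inHexagon, kAnd_eq_true] at h
  refine hI.mem_of_kLeftAny (by simp) hA fun p hp => ?_
  simp only [List.mem_cons, List.not_mem_nil, or_false] at hp
  rcases hp with rfl | rfl | rfl | rfl | rfl | rfl
  · exact ⟨_, by simp, _, by simp, _, by simp, h.1⟩
  · exact ⟨_, by simp, _, by simp, _, by simp, h.2.1⟩
  · exact ⟨_, by simp, _, by simp, _, by simp, h.2.2.1⟩
  · exact ⟨_, by simp, _, by simp, _, by simp, h.2.2.2.1⟩
  · exact ⟨_, by simp, _, by simp, _, by simp, h.2.2.2.2.1⟩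
  · exact ⟨_, by simp, _, by simp, _, by simp, h.2.2.2.2.2⟩

lemma le_ncard_of_kCount (hI : IsLatticeInterior A I) {f : ℕ × ℕ → Bool} {l : List (ℕ × ℕ)}
    (hl : l.Nodup) {n : ℕ} (h : kCount f l n = true) (hf : ∀ q, f q = true → toInt2 q ∈ I) :
    n ≤ I.ncard := by
  have h1 := le_length_filter_of_kCount h
  rw [← List.toFinset_card_of_nodup (hl.filter f)] at h1
  refine h1.trans ?_
  rw [← Finset.card_image_of_injective _ toInt2_injective, ← Set.ncard_coe_finset]
  refine Set.ncard_le_ncard ?_ hI.finite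
  intro p hp
  simp only [Finset.coe_image, Set.mem_image, Finset.mem_coe, List.mem_toFinset,
    List.mem_filter] at hp
  obtain ⟨q, ⟨-, hq⟩, rfl⟩ := hp
  exact hf q hq

end IsLatticeInterior

namespace SquareSearch

variable {A I : Set (ℤ × ℤ)} {D : SquareSearch}

/-- The conclusion of a successful search. -/
def Conclusion (D : SquareSearch) (A I : Set (ℤ × ℤ)) : Prop :=
  D.count ≤ I.ncard ∨
    ∃ t ∈ D.triangles, toInt2 t.1 ∈ A ∧ toInt2 t.2.1 ∈ A ∧ toInt2 t.2.2 ∈ A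

lemma exists_triangle_of_hasTriangle {l : List (ℕ × ℕ)} (hA : ∀ p ∈ l, toInt2 p ∈ A)
    (h : D.hasTriangle l = true) :
    ∃ t ∈ D.triangles, toInt2 t.1 ∈ A ∧ toInt2 t.2.1 ∈ A ∧ toInt2 t.2.2 ∈ A := by
  simp only [hasTriangle, kAny_eq_true, kAnd_eq_true, kEq_eq_true] at h
  obtain ⟨t, ht, ⟨a, ha, ha'⟩, ⟨b, hb, hb'⟩, c, hc, hc'⟩ := h
  exact ⟨t, ht, ha' ▸ hA a ha, hb' ▸ hA b hb, hc' ▸ hA c hc⟩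

lemma conclusion_of_quad (hgrid : D.grid.Nodup) (hI : IsLatticeInterior A I) {a b c d : ℕ × ℕ}
    (hA : ∀ p ∈ [a, b, c, d], toInt2 p ∈ A) (h : D.quad a b c d = true) : D.Conclusion A I := by
  rw [quad, kOr_eq_true] at h
  rcases h with h | h
  · exact Or.inl (hI.le_ncard_of_kCount hgrid h fun q hq => hI.mem_of_inQuad hA hq)
  · exact Or.inr (exists_triangle_of_hasTriangle hA h)

lemma conclusion_of_hexagon (hgrid : D.grid.Nodup) (hI : IsLatticeInterior A I)
    {a b c d e f : ℕ × ℕ} (hA : ∀ p ∈ [a, b, c, d, e, f], toInt2 p ∈ A)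
    (h : D.hexagon a b c d e f = true) : D.Conclusion A I := by
  rw [hexagon, kOr_eq_true] at h
  rcases h with h | h
  · exact Or.inl (hI.le_ncard_of_kCount hgrid h fun q hq => hI.mem_of_inHexagon hA hq)
  · exact Or.inr (exists_triangle_of_hasTriangle hA h)

lemma apply_of_between (hrange : ∀ k ≤ D.side, k ∈ D.range) {lo hi : ℕ} {f : ℕ → Bool}
    (h : D.between lo hi f = true) {k : ℕ} (hk : k ≤ D.side) (h1 : lo ≤ k) (h2 : k ≤ hi) :
    f k = true := by
  rw [between, kAll_eq_true] at h
  have h3 := h k (hrange k hk)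
  rw [kOr_eq_true, kOr_eq_true, Nat.ble_eq, Nat.ble_eq] at h3
  rcases h3 with h3 | h3 | h3
  · omega
  · omega
  · exact h3

/-- Soundness of the search, for contact points in normalized position. -/
lemma conclusion_of_run (hrun : D.run = true) (hrange : ∀ k ≤ D.side, k ∈ D.range)
    (hgrid : D.grid.Nodup) (hI : IsLatticeInterior A I) {C : Set (ℤ × ℤ)} (hCA : C ⊆ A)
    (hC : LatticeConvex C) (hfin : C.Finite) (hwC : WidthAtLeast D.side C)
    (hbox : ∀ p ∈ C, (0 ≤ p.1 ∧ p.1 ≤ D.side) ∧ 0 ≤ p.2 ∧ p.2 ≤ D.side) {a b c e : ℤ}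
    (ha : (0, a) ∈ C) (hc : (c, 0) ∈ C) (hb : ((D.side : ℤ), b) ∈ C) (he : (e, (D.side : ℤ)) ∈ C)
    (hac : D.side - a ≤ c) (hab : D.side - a ≤ b) (hae : e ≤ a) : D.Conclusion A I := by
  have ba := hbox _ ha
  have bb := hbox _ hb
  have bc := hbox _ hc
  have be := hbox _ he
  simp only at ba bb bc be
  lift a to ℕ using by omega
  lift b to ℕ using by omega
  lift c to ℕ using by omega
  lift e to ℕ using by omega
  have h1 := apply_of_between hrange hrun (k := a) (by omega) (by omega) (by omega)
  have h2 := apply_of_between hrange h1 (k := c) (by omega) (by simp only [Nat.sub_eq]; omega)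
    (by omega)
  have h3 := apply_of_between hrange h2 (k := b) (by omega) (by simp only [Nat.sub_eq]; omega)
    (by omega)
  have h4 := apply_of_between hrange h3 (k := e) (by omega) (by omega) (by omega)
  rw [kOr_eq_true, kOr_eq_true] at h4
  have mem : ∀ x y : ℕ, ∀ s t : ℤ, (s, t) ∈ C → (x : ℤ) = s → (y : ℤ) = t →
      toInt2 (x, y) ∈ A := by
    rintro x y s t h rfl rfl
    exact hCA h
  rcases h4 with h4 | h4 | h4
  · refine conclusion_of_quad hgrid hI ?_ h4
    simp only [List.forall_mem_cons, List.not_mem_nil, IsEmpty.forall_iff, implies_true, and_true]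
    exact ⟨mem _ _ _ _ ha rfl rfl, mem _ _ _ _ hc rfl rfl, mem _ _ _ _ hb rfl rfl,
      mem _ _ _ _ he rfl rfl⟩
  · rw [antidiagonals, kAnd_eq_true, Nat.ble_eq, kMax_eq, kMin_eq] at h4
    obtain ⟨hlt, h4⟩ := h4
    obtain ⟨k, hk1, hk2, ⟨i, hi0, hi1, hi⟩, j, hj0, hj1, hj⟩ :=
      exists_antidiagonal_levels hC hwC hfin hbox ha hc hb he (by omega)
    lift k to ℕ using by omega
    lift i to ℕ using hi0
    lift j to ℕ using hj0
    have h5 := apply_of_between hrange h4 (k := k) (by omega) (by omega) (by omega)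
    have h6 := apply_of_between hrange h5 (k := i) (by omega) (by omega)
      (by simp only [Nat.sub_eq]; omega)
    have h7 := apply_of_between hrange h6 (k := j) (by omega) (by omega) (by omega)
    refine conclusion_of_hexagon hgrid hI ?_ h7
    simp only [List.forall_mem_cons, List.not_mem_nil, IsEmpty.forall_iff, implies_true, and_true]
    exact ⟨mem _ _ _ _ ha rfl rfl, mem _ _ _ _ hj rfl (by simp only [Nat.sub_eq]; omega),
      mem _ _ _ _ hc rfl rfl, mem _ _ _ _ hb rfl rfl,
      mem _ _ _ _ hi (by simp only [Nat.sub_eq]; omega) (by simp only [Nat.add_eq]; omega),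
      mem _ _ _ _ he rfl rfl⟩
  · rw [diagonals, kAnd_eq_true, Nat.ble_eq, kMax_eq, kMin_eq] at h4
    simp only [Nat.sub_eq] at h4
    obtain ⟨hlt, h4⟩ := h4
    obtain ⟨k, hk1, hk2, ⟨i, hi0, hi1, hi⟩, j, hj0, hj1, hj⟩ :=
      exists_diagonal_levels hC hwC hfin hbox ha hc hb he (by omega)
    lift k to ℕ using by omega
    lift i to ℕ using hi0
    lift j to ℕ using hj0
    have h5 := apply_of_between hrange h4 (k := k) (by omega) (by omega) (by omega)
    have h6 := apply_of_between hrange h5 (k := i) (by omega) (by omega) (by omega)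
    have h7 := apply_of_between hrange h6 (k := j) (by omega) (by omega) (by omega)
    refine conclusion_of_hexagon hgrid hI ?_ h7
    simp only [List.forall_mem_cons, List.not_mem_nil, IsEmpty.forall_iff, implies_true, and_true]
    exact ⟨mem _ _ _ _ ha rfl rfl, mem _ _ _ _ hc rfl rfl,
      mem _ _ _ _ hi (by simp only [Nat.add_eq]; omega) rfl, mem _ _ _ _ hb rfl rfl,
      mem _ _ _ _ he rfl rfl,
      mem _ _ _ _ hj rfl (by simp only [Nat.add_eq]; omega)⟩

/-- The search in the square of side `5`. -/
def five : SquareSearch where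
  side := 5
  count := 9
  range := [0, 1, 2, 3, 4, 5]
  grid :=
    [(2, 2), (2, 3), (3, 2), (3, 3), (1, 2), (1, 3), (2, 1), (2, 4), (3, 1), (3, 4), (4, 2), (4, 3),
     (1, 1), (1, 4), (4, 1), (4, 4)]
  triangles :=
    [((0, 0), (5, 0), (0, 5)), ((5, 0), (5, 5), (0, 0)), ((5, 5), (0, 5), (5, 0)), ((0, 5),
     (0, 0), (5, 5))]

lemma run_five : five.run = true := by decide +kernel

/-- The search in the square of side `6`. -/
def six : SquareSearch where
  side := 6
  count := 12
  range := [0, 1, 2, 3, 4, 5, 6]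
  grid :=
    [(3, 3), (2, 3), (3, 2), (3, 4), (4, 3), (2, 2), (2, 4), (4, 2), (4, 4), (1, 3), (3, 1), (3, 5),
     (5, 3), (1, 2), (1, 4), (2, 1), (2, 5), (4, 1), (4, 5), (5, 2), (5, 4), (1, 1), (1, 5),
     (5, 1), (5, 5)]
  triangles :=
    [((0, 0), (6, 0), (0, 6)), ((6, 0), (6, 6), (0, 0)), ((6, 6), (0, 6), (6, 0)), ((0, 6),
     (0, 0), (6, 6)), ((0, 0), (6, 3), (3, 6)), ((6, 0), (3, 6), (0, 3)), ((6, 6), (0, 3), (3, 0)),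
     ((0, 6), (3, 0), (6, 3))]

lemma run_six : six.run = true := by decide +kernel

/-- The search in the square of side `7`. -/
def seven : SquareSearch where
  side := 7
  count := 13
  range := [0, 1, 2, 3, 4, 5, 6, 7]
  grid :=
    [(3, 3), (3, 4), (4, 3), (4, 4), (2, 3), (2, 4), (3, 2), (3, 5), (4, 2), (4, 5), (5, 3), (5, 4),
     (2, 2), (2, 5), (5, 2), (5, 5), (1, 3), (1, 4), (3, 1), (3, 6), (4, 1), (4, 6), (6, 3),
     (6, 4), (1, 2), (1, 5), (2, 1), (2, 6), (5, 1), (5, 6), (6, 2), (6, 5), (1, 1), (1, 6), (6, 1),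
     (6, 6)]
  triangles := []

lemma run_seven : seven.run = true := by decide +kernel

end SquareSearch

/-- The lattice points of `[0, w]²` strictly inside the triangle `a b c`, or also on its open
edge `a b`. -/
noncomputable def triangleWithEdge (w : ℤ) (a b c : ℤ × ℤ) : Finset (ℤ × ℤ) :=
  (Finset.Icc 0 w ×ˢ Finset.Icc 0 w).filter fun q =>
    0 < det2 (b - q) (c - q) ∧ 0 < det2 (c - q) (a - q) ∧ 0 ≤ det2 (a - q) (b - q)

/-- The lattice points of `[0, w]²` strictly inside the triangle `a b c`. -/
noncomputable def triangleInterior (w : ℤ) (a b c : ℤ × ℤ) : Finset (ℤ × ℤ) :=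
  (Finset.Icc 0 w ×ˢ Finset.Icc 0 w).filter fun q =>
    0 < det2 (b - q) (c - q) ∧ 0 < det2 (c - q) (a - q) ∧ 0 < det2 (a - q) (b - q)

namespace IsLatticeInterior

variable {A I : Set (ℤ × ℤ)}

lemma mem_of_triangle (hI : IsLatticeInterior A I) {a b c q : ℤ × ℤ} (ha : a ∈ A) (hb : b ∈ A)
    (hc : c ∈ A) (h1 : 0 < det2 (b - q) (c - q)) (h2 : 0 < det2 (c - q) (a - q))
    (h3 : 0 < det2 (a - q) (b - q)) : q ∈ I := by
  refine hI.mem_of_surrounded [a, b, c] (by simp) ?_ q ?_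
  · simp only [List.forall_mem_cons, List.not_mem_nil, IsEmpty.forall_iff, implies_true, and_true]
    exact ⟨ha, hb, hc⟩
  · simp only [List.forall_mem_cons, List.not_mem_nil, IsEmpty.forall_iff, implies_true, and_true]
    exact ⟨⟨b, by simp, h3⟩, ⟨c, by simp, h1⟩, ⟨a, by simp, h2⟩⟩

lemma mem_of_triangleWithEdge (hI : IsLatticeInterior A I) {a b c d q : ℤ × ℤ} (ha : a ∈ A)
    (hb : b ∈ A) (hc : c ∈ A) (hd : d ∈ A) (hneg : det2 (b - a) (d - a) < 0)
    (h1 : 0 < det2 (b - q) (c - q)) (h2 : 0 < det2 (c - q) (a - q))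
    (h3 : 0 ≤ det2 (a - q) (b - q)) : q ∈ I := by
  rcases h3.lt_or_eq with h3 | h3
  · exact hI.mem_of_triangle ha hb hc h1 h2 h3
  have key1 : (det2 (b - q) (c - q) + det2 (c - q) (a - q)) * det2 (a - q) (d - q)
      = det2 (c - q) (a - q) * (- det2 (b - a) (d - a)) := by
    unfold det2 at *
    simp only [Prod.fst_sub, Prod.snd_sub] at *
    linear_combination ((c.1 - q.1) * (d.2 - q.2) - (c.2 - q.2) * (d.1 - q.1)
      - ((c.1 - q.1) * (a.2 - q.2) - (c.2 - q.2) * (a.1 - q.1))) * h3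
  have key2 : (det2 (b - q) (c - q) + det2 (c - q) (a - q)) * det2 (d - q) (b - q)
      = det2 (b - q) (c - q) * (- det2 (b - a) (d - a)) := by
    unfold det2 at *
    simp only [Prod.fst_sub, Prod.snd_sub] at *
    linear_combination -((c.1 - q.1) * (d.2 - q.2) - (c.2 - q.2) * (d.1 - q.1)
      + ((b.1 - q.1) * (c.2 - q.2) - (b.2 - q.2) * (c.1 - q.1))) * h3
  have hsum : 0 < det2 (b - q) (c - q) + det2 (c - q) (a - q) := by omega
  have p1 : 0 < det2 (a - q) (d - q) := by
    refine (mul_pos_iff_of_pos_left hsum).1 ?_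
    rw [key1]
    exact mul_pos h2 (by omega)
  have p2 : 0 < det2 (d - q) (b - q) := by
    refine (mul_pos_iff_of_pos_left hsum).1 ?_
    rw [key2]
    exact mul_pos h1 (by omega)
  refine hI.mem_of_surrounded [a, d, b, c] (by simp) ?_ q ?_
  · simp only [List.forall_mem_cons, List.not_mem_nil, IsEmpty.forall_iff, implies_true, and_true]
    exact ⟨ha, hd, hb, hc⟩
  · simp only [List.forall_mem_cons, List.not_mem_nil, IsEmpty.forall_iff, implies_true, and_true]
    exact ⟨⟨d, by simp, p1⟩, ⟨b, by simp, p2⟩, ⟨c, by simp, h1⟩, ⟨a, by simp, h2⟩⟩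

lemma card_triangleWithEdge_le (hI : IsLatticeInterior A I) {w : ℤ} {a b c d : ℤ × ℤ} (ha : a ∈ A)
    (hb : b ∈ A) (hc : c ∈ A) (hd : d ∈ A) (hneg : det2 (b - a) (d - a) < 0) :
    (triangleWithEdge w a b c).card ≤ I.ncard := by
  rw [← Set.ncard_coe_finset]
  refine Set.ncard_le_ncard (fun q hq => ?_) hI.finite
  obtain ⟨-, h1, h2, h3⟩ := Finset.mem_filter.1 (Finset.mem_coe.1 hq)
  exact hI.mem_of_triangleWithEdge ha hb hc hd hneg h1 h2 h3

lemma det2_pos_of_forall_nonneg (hI : IsLatticeInterior A I) {a b : ℤ × ℤ} (hab : a ≠ b)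
    (h : ∀ d ∈ A, 0 ≤ det2 (b - a) (d - a)) {q : ℤ × ℤ} (hq : q ∈ I) :
    0 < det2 (a - q) (b - q) := by
  have hne : (a.2 - b.2, b.1 - a.1) ≠ (0 : ℤ × ℤ) := by
    intro h0
    rw [Prod.mk_eq_zero] at h0
    exact hab (Prod.ext (by omega) (by omega))
  obtain ⟨p, hp, hlt⟩ := hI.exists_lt q hq _ hne
  have := h p hp
  unfold det2 pairing at *
  simp only [Prod.fst_sub, Prod.snd_sub] at *
  linarith

lemma ncard_eq_of_triangle (hI : IsLatticeInterior A I) {w : ℤ} {a b c : ℤ × ℤ} (ha : a ∈ A)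
    (hb : b ∈ A) (hc : c ∈ A) (hab : a ≠ b) (hbc : b ≠ c) (hca : c ≠ a)
    (hbox : ∀ p ∈ [a, b, c], (0 ≤ p.1 ∧ p.1 ≤ w) ∧ 0 ≤ p.2 ∧ p.2 ≤ w)
    (h1 : ∀ d ∈ A, 0 ≤ det2 (b - a) (d - a)) (h2 : ∀ d ∈ A, 0 ≤ det2 (c - b) (d - b))
    (h3 : ∀ d ∈ A, 0 ≤ det2 (a - c) (d - c)) : I.ncard = (triangleInterior w a b c).card := by
  rw [← Set.ncard_coe_finset]
  congr 1
  ext q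
  rw [Finset.mem_coe, triangleInterior, Finset.mem_filter]
  constructor
  · intro hq
    have p1 := hI.det2_pos_of_forall_nonneg hab h1 hq
    have p2 := hI.det2_pos_of_forall_nonneg hbc h2 hq
    have p3 := hI.det2_pos_of_forall_nonneg hca h3 hq
    refine ⟨?_, p2, p3, p1⟩
    simp only [List.forall_mem_cons, List.not_mem_nil, IsEmpty.forall_iff, implies_true,
      and_true] at hbox
    obtain ⟨ba, bb, bc⟩ := hbox
    have e1 : det2 (b - q) (c - q) * (a.1 - q.1) + det2 (c - q) (a - q) * (b.1 - q.1)
        + det2 (a - q) (b - q) * (c.1 - q.1) = 0 := by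
      unfold det2; simp only [Prod.fst_sub, Prod.snd_sub]; ring
    have e2 : det2 (b - q) (c - q) * (a.2 - q.2) + det2 (c - q) (a - q) * (b.2 - q.2)
        + det2 (a - q) (b - q) * (c.2 - q.2) = 0 := by
      unfold det2; simp only [Prod.fst_sub, Prod.snd_sub]; ring
    have aux : ∀ {r s t x y z : ℤ}, 0 < r → 0 < s → 0 < t → r * x + s * y + t * z = 0 →
        ¬ (0 < x ∧ 0 < y ∧ 0 < z) := by
      rintro r s t x y z hr hs ht h ⟨hx, hy, hz⟩
      have := mul_pos hr hx
      have := mul_pos hs hy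
      have := mul_pos ht hz
      omega
    have f1 := aux p2 p3 p1 e1
    have f2 := aux p2 p3 p1 e2
    have f3 := aux p2 p3 p1 (x := -(a.1 - q.1)) (y := -(b.1 - q.1)) (z := -(c.1 - q.1))
      (by linarith)
    have f4 := aux p2 p3 p1 (x := -(a.2 - q.2)) (y := -(b.2 - q.2)) (z := -(c.2 - q.2))
      (by linarith)
    rw [Finset.mem_product, Finset.mem_Icc, Finset.mem_Icc]
    omega
  · rintro ⟨-, h4, h5, h6⟩
    exact hI.mem_of_triangle ha hb hc h4 h5 h6

end IsLatticeInterior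

/-- A triangle in `[0, w]²` with `m` interior lattice points, which together with the lattice
points on any of the open edges number at least `n`. -/
def IsTightTriangle (w : ℤ) (m n : ℕ) (a b c : ℤ × ℤ) : Prop :=
  a ≠ b ∧ b ≠ c ∧ c ≠ a ∧ (∀ p ∈ [a, b, c], (0 ≤ p.1 ∧ p.1 ≤ w) ∧ 0 ≤ p.2 ∧ p.2 ≤ w) ∧
    (triangleInterior w a b c).card = m ∧ n ≤ (triangleWithEdge w a b c).card ∧
      n ≤ (triangleWithEdge w b c a).card ∧ n ≤ (triangleWithEdge w c a b).card

noncomputable instance (w : ℤ) (m n : ℕ) (a b c : ℤ × ℤ) :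
    Decidable (IsTightTriangle w m n a b c) := by
  unfold IsTightTriangle; infer_instance

lemma IsLatticeInterior.ncard_of_isTightTriangle {A I : Set (ℤ × ℤ)} (hI : IsLatticeInterior A I)
    {w : ℤ} {m n : ℕ} {a b c : ℤ × ℤ} (ht : IsTightTriangle w m n a b c) (ha : a ∈ A) (hb : b ∈ A)
    (hc : c ∈ A) : I.ncard = m ∨ n ≤ I.ncard := by
  obtain ⟨hab, hbc, hca, hbox, hm, h1, h2, h3⟩ := ht
  by_cases hout : (∃ d ∈ A, det2 (b - a) (d - a) < 0) ∨ (∃ d ∈ A, det2 (c - b) (d - b) < 0) ∨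
      ∃ d ∈ A, det2 (a - c) (d - c) < 0
  · right
    rcases hout with ⟨d, hd, hneg⟩ | ⟨d, hd, hneg⟩ | ⟨d, hd, hneg⟩
    · exact h1.trans (hI.card_triangleWithEdge_le ha hb hc hd hneg)
    · exact h2.trans (hI.card_triangleWithEdge_le hb hc ha hd hneg)
    · exact h3.trans (hI.card_triangleWithEdge_le hc ha hb hd hneg)
  · left
    push Not at hout
    rw [← hm]
    exact hI.ncard_eq_of_triangle ha hb hc hab hbc hca hbox hout.1 hout.2.1 hout.2.2

lemma SquareSearch.isTightTriangle_five : ∀ t ∈ SquareSearch.five.triangles,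
    IsTightTriangle 5 6 9 (toInt2 t.1) (toInt2 t.2.1) (toInt2 t.2.2) := by
  decide +kernel

lemma SquareSearch.isTightTriangle_six : ∀ t ∈ SquareSearch.six.triangles,
    IsTightTriangle 6 10 12 (toInt2 t.1) (toInt2 t.2.1) (toInt2 t.2.2) := by
  decide +kernel

/-- The affine map with linear parts `f₁, f₂` and offsets `c₁, c₂`. -/
def affineMap (f₁ f₂ : ℤ × ℤ) (c₁ c₂ : ℤ) (p : ℤ × ℤ) : ℤ × ℤ :=
  (pairing f₁ p - c₁, pairing f₂ p - c₂)

section affineMap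

variable {f₁ f₂ : ℤ × ℤ} {c₁ c₂ : ℤ} {A I : Set (ℤ × ℤ)}

lemma affineMap_injective (hdet : det2 f₁ f₂ = 1) : Function.Injective (affineMap f₁ f₂ c₁ c₂) := by
  intro p r h
  simp only [affineMap, Prod.mk.injEq] at h
  exact eq_of_pairing_eq (by rw [hdet]; norm_num) (by omega) (by omega)

lemma affineMap_surjective (hdet : det2 f₁ f₂ = 1) :
    Function.Surjective (affineMap f₁ f₂ c₁ c₂) := by
  intro q
  refine ⟨(f₂.2 * (q.1 + c₁) - f₁.2 * (q.2 + c₂), f₁.1 * (q.2 + c₂) - f₂.1 * (q.1 + c₁)), ?_⟩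
  unfold affineMap pairing det2 at *
  ext
  · simp only; linear_combination (q.1 + c₁) * hdet
  · simp only; linear_combination (q.2 + c₂) * hdet

lemma det2_affineMap (hdet : det2 f₁ f₂ = 1) (p q r : ℤ × ℤ) :
    det2 (affineMap f₁ f₂ c₁ c₂ p - affineMap f₁ f₂ c₁ c₂ q)
      (affineMap f₁ f₂ c₁ c₂ r - affineMap f₁ f₂ c₁ c₂ q) = det2 (p - q) (r - q) := by
  unfold affineMap pairing det2 at *
  simp only [Prod.fst_sub, Prod.snd_sub]
  linear_combination ((p.1 - q.1) * (r.2 - q.2) - (p.2 - q.2) * (r.1 - q.1)) * hdet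

lemma exists_pairing_affineMap (hdet : det2 f₁ f₂ = 1) {φ : ℤ × ℤ} (hφ : φ ≠ 0) :
    ∃ ψ : ℤ × ℤ, ψ ≠ 0 ∧ ∃ k, ∀ p, pairing φ (affineMap f₁ f₂ c₁ c₂ p) = pairing ψ p - k := by
  refine ⟨(φ.1 * f₁.1 + φ.2 * f₂.1, φ.1 * f₁.2 + φ.2 * f₂.2), ?_, φ.1 * c₁ + φ.2 * c₂, ?_⟩
  · intro h0
    rw [Prod.mk_eq_zero] at h0
    apply hφ
    unfold det2 at hdet
    ext
    · simp only [Prod.fst_zero]; linear_combination f₂.2 * h0.1 - f₂.1 * h0.2 - φ.1 * hdet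
    · simp only [Prod.snd_zero]; linear_combination f₁.1 * h0.2 - f₁.2 * h0.1 - φ.2 * hdet
  · intro p
    unfold affineMap pairing
    simp only
    ring

lemma IsLatticeInterior.image_affineMap (hI : IsLatticeInterior A I) (hdet : det2 f₁ f₂ = 1) :
    IsLatticeInterior (affineMap f₁ f₂ c₁ c₂ '' A) (affineMap f₁ f₂ c₁ c₂ '' I) where
  finite := hI.finite.image _
  mem_of_surrounded L hne hL q hq := by
    set T := affineMap f₁ f₂ c₁ c₂
    have hinj : Function.Injective T := affineMap_injective hdet
    have hsurj : Function.Surjective T := affineMap_surjective hdet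
    obtain ⟨q, rfl⟩ := hsurj q
    obtain ⟨L, rfl⟩ := List.map_surjective_iff.2 hsurj L
    refine Set.mem_image_of_mem T (hI.mem_of_surrounded L (by simpa using hne) ?_ q ?_)
    · exact fun p hp => hinj.mem_set_image.1 (hL _ (List.mem_map_of_mem hp))
    · intro p hp
      obtain ⟨a, ha, hpos⟩ := hq _ (List.mem_map_of_mem hp)
      obtain ⟨a, ha', rfl⟩ := List.mem_map.1 ha
      exact ⟨a, ha', by rwa [det2_affineMap hdet] at hpos⟩
  exists_lt := by
    rintro _ ⟨q, hq, rfl⟩ φ hφ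
    obtain ⟨ψ, hψ, k, hk⟩ := exists_pairing_affineMap (c₁ := c₁) (c₂ := c₂) hdet hφ
    obtain ⟨p, hp, hlt⟩ := hI.exists_lt q hq ψ hψ
    exact ⟨_, Set.mem_image_of_mem _ hp, by rw [hk, hk]; omega⟩

lemma WidthAtLeast.image_affineMap {w : ℤ} {C : Set (ℤ × ℤ)} (hC : WidthAtLeast w C)
    (hdet : det2 f₁ f₂ = 1) : WidthAtLeast w (affineMap f₁ f₂ c₁ c₂ '' C) := by
  intro φ hφ
  obtain ⟨ψ, hψ, k, hk⟩ := exists_pairing_affineMap (c₁ := c₁) (c₂ := c₂) hdet hφ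
  obtain ⟨p, hp, r, hr, hpr⟩ := hC ψ hψ
  exact ⟨_, Set.mem_image_of_mem _ hp, _, Set.mem_image_of_mem _ hr, by rw [hk, hk]; omega⟩

lemma LatticeConvex.image_affineMap {C : Set (ℤ × ℤ)} (hC : LatticeConvex C)
    (hdet : det2 f₁ f₂ = 1) : LatticeConvex (affineMap f₁ f₂ c₁ c₂ '' C) := by
  rintro _ ⟨a, ha, rfl⟩ _ ⟨b, hb, rfl⟩ _ ⟨c, hc, rfl⟩ α β γ hα hβ hγ hpos q h1 h2
  obtain ⟨q, rfl⟩ := affineMap_surjective (c₁ := c₁) (c₂ := c₂) hdet q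
  refine Set.mem_image_of_mem _ (hC a ha b hb c hc α β γ hα hβ hγ hpos q ?_ ?_)
  · unfold affineMap pairing det2 at *
    simp only at h1 h2
    linear_combination f₂.2 * h1 - f₁.2 * h2
      - ((α + β + γ) * q.1 - (α * a.1 + β * b.1 + γ * c.1)) * hdet
  · unfold affineMap pairing det2 at *
    simp only at h1 h2
    linear_combination f₁.1 * h2 - f₂.1 * h1
      - ((α + β + γ) * q.2 - (α * a.2 + β * b.2 + γ * c.2)) * hdet

end affineMap

/-- Unimodular coordinates in which `C` lies in the square `[0, w]²`, together with points of `C`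
on its left, lower, right and upper side. -/
structure SquareFrame (w : ℤ) (C : Set (ℤ × ℤ)) (f₁ f₂ : ℤ × ℤ) (c₁ c₂ : ℤ)
    (p₁ p₂ p₃ p₄ : ℤ × ℤ) : Prop where
  det : det2 f₁ f₂ = 1
  box : ∀ p ∈ C, (0 ≤ pairing f₁ p - c₁ ∧ pairing f₁ p - c₁ ≤ w) ∧
    (0 ≤ pairing f₂ p - c₂ ∧ pairing f₂ p - c₂ ≤ w)
  mem₁ : p₁ ∈ C
  mem₂ : p₂ ∈ C
  mem₃ : p₃ ∈ C
  mem₄ : p₄ ∈ C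
  left : pairing f₁ p₁ - c₁ = 0
  lower : pairing f₂ p₂ - c₂ = 0
  right : pairing f₁ p₃ - c₁ = w
  upper : pairing f₂ p₄ - c₂ = w

lemma pairing_neg (φ p : ℤ × ℤ) : pairing (-φ) p = - pairing φ p := by
  unfold pairing; simp only [Prod.fst_neg, Prod.snd_neg]; ring

lemma SquareFrame.rotate {w : ℤ} {C : Set (ℤ × ℤ)} {f₁ f₂ : ℤ × ℤ} {c₁ c₂ : ℤ}
    {p₁ p₂ p₃ p₄ : ℤ × ℤ} (h : SquareFrame w C f₁ f₂ c₁ c₂ p₁ p₂ p₃ p₄) :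
    SquareFrame w C (-f₂) f₁ (-c₂ - w) c₁ p₄ p₁ p₂ p₃ where
  det := by
    have := h.det
    unfold det2 at *
    simp only [Prod.fst_neg, Prod.snd_neg]
    linarith
  box p hp := by
    have := h.box p hp
    rw [pairing_neg]
    omega
  mem₁ := h.mem₄
  mem₂ := h.mem₁
  mem₃ := h.mem₂
  mem₄ := h.mem₃
  left := by rw [pairing_neg]; linarith [h.upper]
  lower := h.left
  right := by rw [pairing_neg]; linarith [h.lower]
  upper := h.right

lemma exists_squareFrame {w : ℤ} {C : Set (ℤ × ℤ)} (hwC : WidthAtLeast w C)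
    (hfit : FitsInSquare w C) :
    ∃ f₁ f₂ c₁ c₂ p₁ p₂ p₃ p₄, SquareFrame w C f₁ f₂ c₁ c₂ p₁ p₂ p₃ p₄ := by
  obtain ⟨f₁, f₂, c₁, c₂, hdet, hbox⟩ := hfit
  obtain ⟨p₃, hp₃, p₁, hp₁, h1⟩ := hwC f₁ (by rintro rfl; simp [det2] at hdet)
  obtain ⟨p₄, hp₄, p₂, hp₂, h2⟩ := hwC f₂ (by rintro rfl; simp [det2] at hdet)
  have b1 := hbox p₁ hp₁
  have b2 := hbox p₂ hp₂
  have b3 := hbox p₃ hp₃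
  have b4 := hbox p₄ hp₄
  exact ⟨f₁, f₂, c₁, c₂, p₁, p₂, p₃, p₄, hdet, hbox, hp₁, hp₂, hp₃, hp₄, by omega, by omega,
    by omega, by omega⟩

namespace SquareSearch

variable {A I : Set (ℤ × ℤ)} {D : SquareSearch}

lemma exists_conclusion_of_squareFrame (hrun : D.run = true) (hrange : ∀ k ≤ D.side, k ∈ D.range)
    (hgrid : D.grid.Nodup) (hI : IsLatticeInterior A I) {C : Set (ℤ × ℤ)} (hCA : C ⊆ A)
    (hC : LatticeConvex C) (hfin : C.Finite) (hwC : WidthAtLeast D.side C) {f₁ f₂ : ℤ × ℤ}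
    {c₁ c₂ : ℤ} {p₁ p₂ p₃ p₄ : ℤ × ℤ} (hF : SquareFrame D.side C f₁ f₂ c₁ c₂ p₁ p₂ p₃ p₄)
    (h₂ : D.side - (pairing f₂ p₁ - c₂) ≤ pairing f₁ p₂ - c₁)
    (h₃ : D.side - (pairing f₂ p₁ - c₂) ≤ pairing f₂ p₃ - c₂)
    (h₄ : pairing f₁ p₄ - c₁ ≤ pairing f₂ p₁ - c₂) :
    ∃ A' I', IsLatticeInterior A' I' ∧ I'.ncard = I.ncard ∧ D.Conclusion A' I' := by
  refine ⟨_, _, hI.image_affineMap (c₁ := c₁) (c₂ := c₂) hF.det,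
    Set.ncard_image_of_injective _ (affineMap_injective hF.det), ?_⟩
  refine conclusion_of_run hrun hrange hgrid (hI.image_affineMap hF.det) (Set.image_mono hCA)
    (hC.image_affineMap hF.det) (hfin.image _) (hwC.image_affineMap hF.det) ?_
    ⟨p₁, hF.mem₁, Prod.ext hF.left rfl⟩ ⟨p₂, hF.mem₂, Prod.ext rfl hF.lower⟩
    ⟨p₃, hF.mem₃, Prod.ext hF.right rfl⟩ ⟨p₄, hF.mem₄, Prod.ext rfl hF.upper⟩ h₂ h₃ h₄
  rintro _ ⟨p, hp, rfl⟩
  exact hF.box p hp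

lemma exists_conclusion_of_fitsInSquare (hrun : D.run = true)
    (hrange : ∀ k ≤ D.side, k ∈ D.range) (hgrid : D.grid.Nodup) (hI : IsLatticeInterior A I)
    {C : Set (ℤ × ℤ)} (hCA : C ⊆ A) (hC : LatticeConvex C) (hfin : C.Finite)
    (hwC : WidthAtLeast D.side C) (hfit : FitsInSquare D.side C) :
    ∃ A' I', IsLatticeInterior A' I' ∧ I'.ncard = I.ncard ∧ D.Conclusion A' I' := by
  obtain ⟨f₁, f₂, c₁, c₂, p₁, p₂, p₃, p₄, hF⟩ := exists_squareFrame hwC hfit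
  have core := fun {f₁ f₂ c₁ c₂ p₁ p₂ p₃ p₄} =>
    exists_conclusion_of_squareFrame hrun hrange hgrid hI hCA hC hfin hwC
      (f₁ := f₁) (f₂ := f₂) (c₁ := c₁) (c₂ := c₂) (p₁ := p₁) (p₂ := p₂) (p₃ := p₃) (p₄ := p₄)
  set m₁ := D.side - (pairing f₂ p₁ - c₂) with hm₁
  set m₂ := pairing f₁ p₂ - c₁ with hm₂
  set m₃ := pairing f₂ p₃ - c₂ with hm₃
  set m₄ := D.side - (pairing f₁ p₄ - c₁) with hm₄
  by_cases h1 : m₁ ≤ m₂ ∧ m₁ ≤ m₃ ∧ m₁ ≤ m₄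
  · exact core hF (by omega) (by omega) (by omega)
  by_cases h4 : m₄ ≤ m₁ ∧ m₄ ≤ m₂ ∧ m₄ ≤ m₃
  · exact core hF.rotate (by rw [pairing_neg]; omega) (by omega) (by rw [pairing_neg]; omega)
  by_cases h3 : m₃ ≤ m₄ ∧ m₃ ≤ m₁ ∧ m₃ ≤ m₂
  · refine core hF.rotate.rotate ?_ ?_ ?_ <;> simp only [pairing_neg] <;> omega
  · refine core hF.rotate.rotate.rotate ?_ ?_ ?_ <;> simp only [pairing_neg] <;> omega

/-- The search applies to every finite lattice-convex set of width at least `D.side`. -/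
lemma exists_conclusion (hrun : D.run = true) (hrange : ∀ k ≤ D.side, k ∈ D.range)
    (hgrid : D.grid.Nodup) (hside : 2 ≤ D.side) (hI : IsLatticeInterior A I) (hfin : A.Finite)
    (hA : LatticeConvex A) (hwA : WidthAtLeast D.side A) :
    ∃ A' I', IsLatticeInterior A' I' ∧ I'.ncard = I.ncard ∧ D.Conclusion A' I' := by
  obtain ⟨C, hCA, hC, hwC, hfit⟩ := exists_fitsInSquare hfin hA (by exact_mod_cast hside) hwA
  exact exists_conclusion_of_fitsInSquare hrun hrange hgrid hI hCA hC (hfin.subset hCA) hwC hfit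

end SquareSearch

section ncard

variable {A I : Set (ℤ × ℤ)}

lemma IsLatticeInterior.ncard_of_width_five (hI : IsLatticeInterior A I) (hfin : A.Finite)
    (hA : LatticeConvex A) (hwA : WidthAtLeast 5 A) : I.ncard = 6 ∨ 9 ≤ I.ncard := by
  obtain ⟨A', I', hI', hcard, h | ⟨t, ht, ha, hb, hc⟩⟩ := SquareSearch.exists_conclusion
    SquareSearch.run_five (by decide) (by decide) (by decide) hI hfin hA hwA
  · exact Or.inr (hcard ▸ h)
  · exact hcard ▸ hI'.ncard_of_isTightTriangle (SquareSearch.isTightTriangle_five t ht) ha hb hc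

lemma IsLatticeInterior.ncard_of_width_six (hI : IsLatticeInterior A I) (hfin : A.Finite)
    (hA : LatticeConvex A) (hwA : WidthAtLeast 6 A) : I.ncard = 10 ∨ 12 ≤ I.ncard := by
  obtain ⟨A', I', hI', hcard, h | ⟨t, ht, ha, hb, hc⟩⟩ := SquareSearch.exists_conclusion
    SquareSearch.run_six (by decide) (by decide) (by decide) hI hfin hA hwA
  · exact Or.inr (hcard ▸ h)
  · exact hcard ▸ hI'.ncard_of_isTightTriangle (SquareSearch.isTightTriangle_six t ht) ha hb hc

lemma IsLatticeInterior.ncard_of_width_seven (hI : IsLatticeInterior A I) (hfin : A.Finite)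
    (hA : LatticeConvex A) (hwA : WidthAtLeast 7 A) : 13 ≤ I.ncard := by
  obtain ⟨A', I', hI', hcard, h | ⟨t, ht, -⟩⟩ := SquareSearch.exists_conclusion
    SquareSearch.run_seven (by decide) (by decide) (by decide) hI hfin hA hwA
  · exact hcard ▸ h
  · exact absurd ht List.not_mem_nil

end ncard

lemma mem_convexHull_of_surrounded {s : Set (ℝ × ℝ)} (hs : s.Finite) (hne : s.Nonempty)
    {x : ℝ × ℝ}
    (h : ∀ p ∈ s, ∃ a ∈ s, 0 < (p.1 - x.1) * (a.2 - x.2) - (p.2 - x.2) * (a.1 - x.1)) :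
    x ∈ convexHull ℝ s := by
  by_contra hx
  obtain ⟨f, u, hfs, hfx⟩ := geometric_hahn_banach_closed_point (convex_convexHull ℝ s)
    (hs.isCompact_convexHull ℝ).isClosed hx
  have hf : ∀ v : ℝ × ℝ, f v = f (1, 0) * v.1 + f (0, 1) * v.2 := by
    intro v
    have hv : v = v.1 • ((1 : ℝ), (0 : ℝ)) + v.2 • ((0 : ℝ), (1 : ℝ)) := by ext <;> simp
    conv_lhs => rw [hv, map_add, map_smul, map_smul]
    simp only [smul_eq_mul]
    ring
  have hpos : ∀ p ∈ s, 0 < f x - f p := fun p hp => by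
    linarith [hfs p (subset_convexHull ℝ s hp)]
  obtain ⟨p, hp, hmin⟩ := Set.exists_min_image s
    (fun p => (f (1, 0) * (p.2 - x.2) - f (0, 1) * (p.1 - x.1)) / (f x - f p)) hs hne
  obtain ⟨a, ha, hpa⟩ := h p hp
  have hle := hmin a ha
  rw [div_le_div_iff₀ (hpos p hp) (hpos a ha)] at hle
  have hne0 : 0 < f (1, 0) ^ 2 + f (0, 1) ^ 2 := by
    by_contra h0
    have h1 : f (1, 0) = 0 := by nlinarith [sq_nonneg (f (1, 0)), sq_nonneg (f (0, 1))]
    have h2 : f (0, 1) = 0 := by nlinarith [sq_nonneg (f (1, 0)), sq_nonneg (f (0, 1))]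
    have := hpos p hp
    rw [hf x, hf p, h1, h2] at this
    simp at this
  rw [hf x, hf p, hf a] at hle
  nlinarith [mul_pos hne0 hpa]

lemma toReal2_fst (p : ℤ × ℤ) : (toReal2 p).1 = p.1 := rfl

lemma toReal2_snd (p : ℤ × ℤ) : (toReal2 p).2 = p.2 := rfl

lemma interiorLatticePoints_subset (P : Set (ℝ × ℝ)) :
    interiorLatticePoints P ⊆ latticePoints P :=
  fun _ hp => interior_subset (s := P) hp

lemma mem_interiorLatticePoints_of_surrounded {P : Set (ℝ × ℝ)} (hP : Convex ℝ P)
    {L : List (ℤ × ℤ)} (hne : L ≠ []) (hL : ∀ p ∈ L, p ∈ latticePoints P) {q : ℤ × ℤ}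
    (h : ∀ p ∈ L, ∃ a ∈ L, 0 < det2 (p - q) (a - q)) : q ∈ interiorLatticePoints P := by
  set s : Set (ℝ × ℝ) := toReal2 '' {p | p ∈ L} with hs
  have hfin : s.Finite := (List.finite_toSet L).image _
  have hsP : convexHull ℝ s ⊆ P := convexHull_min (by rintro _ ⟨p, hp, rfl⟩; exact hL p hp) hP
  set U : Set (ℝ × ℝ) := ⋂ p ∈ s, ⋃ a ∈ s,
    {x | 0 < (p.1 - x.1) * (a.2 - x.2) - (p.2 - x.2) * (a.1 - x.1)} with hU
  have hUo : IsOpen U := hfin.isOpen_biInter fun p _ => isOpen_biUnion fun a _ =>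
    isOpen_lt continuous_const (by fun_prop)
  have hsne : s.Nonempty := by
    obtain ⟨p, hp⟩ := List.exists_mem_of_ne_nil L hne
    exact ⟨_, p, hp, rfl⟩
  refine mem_interior.2 ⟨U, fun x hx => hsP (mem_convexHull_of_surrounded hfin hsne ?_), hUo, ?_⟩
  · simpa [U] using hx
  · simp only [hU, Set.mem_iInter, Set.mem_iUnion]
    rintro _ ⟨p, hp, rfl⟩
    obtain ⟨a, ha, hpa⟩ := h p hp
    refine ⟨_, ⟨a, ha, rfl⟩, ?_⟩
    simp only [Set.mem_ofPred_eq, toReal2_fst, toReal2_snd]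
    unfold det2 at hpa
    simp only [Prod.fst_sub, Prod.snd_sub] at hpa
    exact_mod_cast hpa

lemma exists_pairing_lt_of_mem_interiorLatticePoints {S : Set (ℤ × ℤ)} {q φ : ℤ × ℤ}
    (hq : q ∈ interiorLatticePoints (convexHull ℝ (toReal2 '' S))) (hφ : φ ≠ 0) :
    ∃ p ∈ latticePoints (convexHull ℝ (toReal2 '' S)), pairing φ p < pairing φ q := by
  by_contra! hle
  have hhalf : convexHull ℝ (toReal2 '' S) ⊆
      {x : ℝ × ℝ | (pairing φ q : ℝ) ≤ φ.1 * x.1 + φ.2 * x.2} := by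
    refine convexHull_min ?_ (convex_halfSpace_ge (f := fun x : ℝ × ℝ => φ.1 * x.1 + φ.2 * x.2)
      ⟨fun x y => ?_, fun c x => ?_⟩ _)
    · rintro _ ⟨p, hp, rfl⟩
      have := hle p (subset_convexHull ℝ _ ⟨p, hp, rfl⟩)
      simp only [Set.mem_ofPred_eq, toReal2_fst, toReal2_snd]
      unfold pairing at this ⊢
      exact_mod_cast this
    · simp only [Prod.fst_add, Prod.snd_add]; ring
    · simp only [Prod.smul_fst, Prod.smul_snd, smul_eq_mul]; ring
  have hmem : toReal2 q ∈ interior (convexHull ℝ (toReal2 '' S)) := hq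
  set γ : ℝ → ℝ × ℝ := fun t => ((q.1 : ℝ) - t * φ.1, (q.2 : ℝ) - t * φ.2) with hγ
  have hcont : Continuous γ := by fun_prop
  have h0 : γ 0 ∈ interior (convexHull ℝ (toReal2 '' S)) := by simpa [hγ, toReal2] using hmem
  have hev : ∀ᶠ t in nhdsWithin (0 : ℝ) (Set.Ioi 0),
      γ t ∈ interior (convexHull ℝ (toReal2 '' S)) :=
    (hcont.continuousAt.eventually (isOpen_interior.mem_nhds h0)).filter_mono nhdsWithin_le_nhds
  obtain ⟨t, ht, ht0⟩ := (hev.and self_mem_nhdsWithin).exists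
  have hge := hhalf (interior_subset ht)
  have hpos : (0 : ℝ) < (φ.1 : ℝ) ^ 2 + (φ.2 : ℝ) ^ 2 := by
    have : φ.1 ≠ 0 ∨ φ.2 ≠ 0 := by
      by_contra! h
      exact hφ (Prod.ext h.1 h.2)
    rcases this with h | h
    · have : (φ.1 : ℝ) ≠ 0 := by exact_mod_cast h
      positivity
    · have : (φ.2 : ℝ) ≠ 0 := by exact_mod_cast h
      positivity
  simp only [hγ, Set.mem_ofPred_eq, pairing, Int.cast_add, Int.cast_mul] at hge
  nlinarith [mul_pos (Set.mem_Ioi.1 ht0) hpos]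

lemma finite_latticePoints {P : Set (ℝ × ℝ)} (hP : Bornology.IsBounded P) :
    (latticePoints P).Finite := by
  obtain ⟨R, hR⟩ := hP.exists_norm_le
  refine (Set.finite_Icc ((-⌈R⌉, -⌈R⌉) : ℤ × ℤ) (⌈R⌉, ⌈R⌉)).subset fun p hp => ?_
  have h := hR _ hp
  have h1 := abs_le.1 ((norm_fst_le (toReal2 p)).trans h)
  have h2 := abs_le.1 ((norm_snd_le (toReal2 p)).trans h)
  simp only [toReal2_fst, toReal2_snd] at h1 h2
  have hc := Int.le_ceil R
  have e1 : (-⌈R⌉ : ℤ) ≤ p.1 := by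
    have : (-(⌈R⌉ : ℝ)) ≤ p.1 := by linarith
    exact_mod_cast this
  have e2 : (-⌈R⌉ : ℤ) ≤ p.2 := by
    have : (-(⌈R⌉ : ℝ)) ≤ p.2 := by linarith
    exact_mod_cast this
  have e3 : p.1 ≤ ⌈R⌉ := by
    have : (p.1 : ℝ) ≤ ⌈R⌉ := by linarith
    exact_mod_cast this
  have e4 : p.2 ≤ ⌈R⌉ := by
    have : (p.2 : ℝ) ≤ ⌈R⌉ := by linarith
    exact_mod_cast this
  exact ⟨⟨e1, e2⟩, ⟨e3, e4⟩⟩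

lemma latticeConvex_latticePoints {P : Set (ℝ × ℝ)} (hP : Convex ℝ P) :
    LatticeConvex (latticePoints P) := by
  intro a ha b hb c hc α β γ hα hβ hγ hsum q h1 h2
  have hs : (0 : ℝ) < (α : ℝ) + β + γ := by exact_mod_cast hsum
  have hα' : (0 : ℝ) ≤ α := by exact_mod_cast hα
  have hβ' : (0 : ℝ) ≤ β := by exact_mod_cast hβ
  have hγ' : (0 : ℝ) ≤ γ := by exact_mod_cast hγ
  have h1' : ((α : ℝ) + β + γ) * q.1 = α * a.1 + β * b.1 + γ * c.1 := by exact_mod_cast h1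
  have h2' : ((α : ℝ) + β + γ) * q.2 = α * a.2 + β * b.2 + γ * c.2 := by exact_mod_cast h2
  have hmem := hP.sum_mem (t := Finset.univ)
    (w := ![α / ((α : ℝ) + β + γ), β / ((α : ℝ) + β + γ), γ / ((α : ℝ) + β + γ)])
    (z := ![toReal2 a, toReal2 b, toReal2 c])
    (by intro i _; fin_cases i <;> simp <;> positivity)
    (by simp [Fin.sum_univ_three]; field_simp)
    (by intro i _; fin_cases i; exacts [ha, hb, hc])
  have hq : toReal2 q = ∑ i, ![α / ((α : ℝ) + β + γ), β / ((α : ℝ) + β + γ),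
      γ / ((α : ℝ) + β + γ)] i • ![toReal2 a, toReal2 b, toReal2 c] i := by
    simp only [Fin.sum_univ_three, Matrix.cons_val]
    ext
    · simp [toReal2]; field_simp; linarith
    · simp [toReal2]; field_simp; linarith
  show toReal2 q ∈ P
  rw [hq]
  exact hmem

lemma exists_dirWidth_eq {P : Set (ℝ × ℝ)} (hfin : (latticePoints P).Finite)
    (hne : (latticePoints P).Nonempty) (φ : ℤ × ℤ) :
    ∃ p ∈ latticePoints P, ∃ r ∈ latticePoints P, dirWidth P φ = pairing φ p - pairing φ r := by
  have hne' := hne.image (pairing φ)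
  have hf := hfin.image (pairing φ)
  obtain ⟨p, hp, hp'⟩ := Int.csSup_mem hne' hf.bddAbove
  obtain ⟨r, hr, hr'⟩ := Int.csInf_mem hne' hf.bddBelow
  exact ⟨p, hp, r, hr, by rw [hp', hr']; rfl⟩

lemma dirWidth_nonneg {P : Set (ℝ × ℝ)} (hfin : (latticePoints P).Finite)
    (hne : (latticePoints P).Nonempty) (φ : ℤ × ℤ) : 0 ≤ dirWidth P φ := by
  have hf := hfin.image (pairing φ)
  exact sub_nonneg.2 (csInf_le_csSup (hne.image _) hf.bddBelow hf.bddAbove)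

lemma widthAtLeast_latticeWidth {P : Set (ℝ × ℝ)} (hfin : (latticePoints P).Finite)
    (hne : (latticePoints P).Nonempty) {w : ℤ} (hw : w ≤ latticeWidth P) :
    WidthAtLeast w (latticePoints P) := by
  intro φ hφ
  obtain ⟨p, hp, r, hr, h⟩ := exists_dirWidth_eq hfin hne φ
  refine ⟨p, hp, r, hr, h ▸ hw.trans (csInf_le ⟨0, ?_⟩ ⟨φ, hφ, rfl⟩)⟩
  rintro _ ⟨ψ, -, rfl⟩
  exact dirWidth_nonneg hfin hne ψ

section polygon

variable (S : Finset (ℤ × ℤ))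

lemma finite_latticePoints_convexHull :
    (latticePoints (convexHull ℝ (toReal2 '' (S : Set (ℤ × ℤ))))).Finite :=
  finite_latticePoints ((S.finite_toSet.image _).isCompact_convexHull ℝ).isBounded

lemma isLatticeInterior_convexHull :
    IsLatticeInterior (latticePoints (convexHull ℝ (toReal2 '' (S : Set (ℤ × ℤ)))))
      (interiorLatticePoints (convexHull ℝ (toReal2 '' (S : Set (ℤ × ℤ))))) where
  finite := (finite_latticePoints_convexHull S).subset (interiorLatticePoints_subset _)
  mem_of_surrounded _ hne hL _ h :=
    mem_interiorLatticePoints_of_surrounded (convex_convexHull ℝ _) hne hL h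
  exists_lt _ hq _ hφ := exists_pairing_lt_of_mem_interiorLatticePoints hq hφ

end polygon

/-- If `P` is a convex lattice polygon with exactly `g` interior lattice
points, then: if `g = 7` or `g = 8` the lattice width of `P` is at most `4`; if `g = 9` or
`g = 11` it is at most `5`; and if `g = 12` it is at most `6`. -/
theorem latticeWidth_bounds_of_interior_count (S : Finset (ℤ × ℤ)) (P : Set (ℝ × ℝ))
    (hP : P = convexHull ℝ (toReal2 '' (S : Set (ℤ × ℤ))))
    (g : ℕ) (hg : (interiorLatticePoints P).ncard = g) :
    ((g = 7 ∨ g = 8) → latticeWidth P ≤ 4) ∧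
    ((g = 9 ∨ g = 11) → latticeWidth P ≤ 5) ∧
    (g = 12 → latticeWidth P ≤ 6) := by
  subst hP
  have hI := isLatticeInterior_convexHull S
  have hfin := finite_latticePoints_convexHull S
  have hA := latticeConvex_latticePoints (convex_convexHull ℝ (toReal2 '' (S : Set (ℤ × ℤ))))
  generalize convexHull ℝ (toReal2 '' (S : Set (ℤ × ℤ))) = P at *
  have hwidth (hg0 : g ≠ 0) {w : ℤ} (hw : w ≤ latticeWidth P) :
      WidthAtLeast w (latticePoints P) := by
    obtain ⟨q, hq⟩ := Set.nonempty_of_ncard_ne_zero (hg ▸ hg0)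
    exact widthAtLeast_latticeWidth hfin ⟨q, interiorLatticePoints_subset P hq⟩ hw
  refine ⟨fun h => ?_, fun h => ?_, fun h => ?_⟩
  · by_contra! hw
    have := hI.ncard_of_width_five hfin hA (hwidth (by omega) hw)
    omega
  · by_contra! hw
    have := hI.ncard_of_width_six hfin hA (hwidth (by omega) hw)
    omega
  · by_contra! hw
    have := hI.ncard_of_width_seven hfin hA (hwidth (by omega) hw)
    omega
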